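/- There exist β₀ > 0 and constants c₀ > c₁ > 0 such that for every β ≥ β₀ and every integer h ≥ 2 there exists L₀ = L₀(β,h) such that for all integers L ≥ L₀: e^{−c₀·β·h/log h} ≤ π_{B_L}(η_0 = h)/π_{B_L}(η_0 = h−1) ≤ e^{−c₁·β·h/log h}. -/

import Mathlib

open Filter Topology Classical

noncomputable section

abbrev Site : Type := ℤ × ℤ

/-- Nearest-neighbor adjacency in `ℤ²`. -/
def adjP (x y : Site) : Prop := |x.1 - y.1| + |x.2 - y.2| = 1

/-- The Discrete Gaussian Hamiltonian `H(η) = ∑_{x∼y} (η_x - η_y)²`, the sum running over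
unordered nearest-neighbor pairs (each ordered pair is counted once, whence the factor 1/2). -/
def dgH (η : Site → ℤ) : ℝ :=
  (1 / 2) * ∑' p : Site × Site, if adjP p.1 p.2 then ((η p.1 - η p.2 : ℤ) : ℝ) ^ 2 else 0

/-- Unnormalized weight of the event `A` for the DG model on `Λ` with zero boundary conditions. -/
def dgW (β : ℝ) (Λ : Finset Site) (A : (Site → ℤ) → Prop) : ℝ :=
  ∑' η : Site → ℤ, if (∀ x ∉ Λ, η x = 0) ∧ A η then Real.exp (-β * dgH η) else 0

/-- `π_Λ(A)`: probability of the event `A` under the DG measure on `Λ`. -/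
def dgProb (β : ℝ) (Λ : Finset Site) (A : (Site → ℤ) → Prop) : ℝ :=
  dgW β Λ A / dgW β Λ (fun _ => True)

/-- `ϖ_Λ(A)`: DG measure conditioned on the floor event `η ≥ 0`. -/
def dgProbFloor (β : ℝ) (Λ : Finset Site) (A : (Site → ℤ) → Prop) : ℝ :=
  dgW β Λ (fun η => A η ∧ ∀ x, 0 ≤ η x) / dgW β Λ (fun η => ∀ x, 0 ≤ η x)

/-- The box `Λ_L = {1,…,L}²`. -/
def box (L : ℕ) : Finset Site := Finset.Icc (1 : ℤ) (L : ℤ) ×ˢ Finset.Icc (1 : ℤ) (L : ℤ)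

/-- The lattice ball `B_r = {x ∈ ℤ² : |x| ≤ r}`. -/
def ball (r : ℝ) : Finset Site :=
  ((Finset.Icc (-⌈r⌉) ⌈r⌉) ×ˢ (Finset.Icc (-⌈r⌉) ⌈r⌉)).filter
    fun x => ((x.1 : ℝ) ^ 2 + (x.2 : ℝ) ^ 2 ≤ r ^ 2)


def en (D : Finset (Site × Site)) (u : Site → ℝ) : ℝ := ∑ e ∈ D, (u e.1 - u e.2) ^ 2

def bil (D : Finset (Site × Site)) (u v : Site → ℝ) : ℝ :=
  ∑ e ∈ D, (u e.1 - u e.2) * (v e.1 - v e.2)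

lemma en_nonneg (D : Finset (Site × Site)) (u : Site → ℝ) : 0 ≤ en D u :=
  Finset.sum_nonneg fun _ _ => sq_nonneg _

lemma en_add (D : Finset (Site × Site)) (u v : Site → ℝ) :
    en D (u + v) = en D u + en D v + 2 * bil D u v := by
  simp only [en, bil, Finset.mul_sum, ← Finset.sum_add_distrib]
  refine Finset.sum_congr rfl fun e _ => ?_
  simp only [Pi.add_apply]; ring

lemma en_sub (D : Finset (Site × Site)) (u v : Site → ℝ) :
    en D (u - v) = en D u + en D v - 2 * bil D u v := by
  simp only [en, bil, Finset.mul_sum, ← Finset.sum_add_distrib, ← Finset.sum_sub_distrib]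
  refine Finset.sum_congr rfl fun e _ => ?_
  simp only [Pi.sub_apply]; ring

lemma en_neg (D : Finset (Site × Site)) (u : Site → ℝ) : en D (-u) = en D u := by
  simp only [en]
  refine Finset.sum_congr rfl fun e _ => ?_
  simp only [Pi.neg_apply]; ring

lemma en_smul (D : Finset (Site × Site)) (t : ℝ) (u : Site → ℝ) :
    en D (t • u) = t ^ 2 * en D u := by
  simp only [en, Finset.mul_sum]
  refine Finset.sum_congr rfl fun e _ => ?_
  simp only [Pi.smul_apply, smul_eq_mul]; ring

def LatS (S : Finset Site) : AddSubgroup (Site → ℤ) where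
  carrier := {n | ∀ x ∉ S, n x = 0}
  add_mem' := by intro a b ha hb x hx; simp [ha x hx, hb x hx]
  zero_mem' := by intro x _; rfl
  neg_mem' := by intro a ha x hx; simp [ha x hx]

lemma mem_LatS {S : Finset Site} {n : Site → ℤ} : n ∈ LatS S ↔ ∀ x ∉ S, n x = 0 := Iff.rfl

/-- real version of integer function -/
def re (n : Site → ℤ) : Site → ℝ := fun x => (n x : ℝ)

lemma re_add (n m : Site → ℤ) : re (n + m) = re n + re m := by ext x; simp [re]
lemma re_sub (n m : Site → ℤ) : re (n - m) = re n - re m := by ext x; simp [re]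
lemma re_neg (n : Site → ℤ) : re (-n) = - re n := by ext x; simp [re]
lemma re_zero : re 0 = 0 := by ext x; simp [re]

/-- weight -/
def wt (D : Finset (Site × Site)) (β : ℝ) (u : Site → ℝ) : ENNReal :=
  ENNReal.ofReal (Real.exp (-β * en D u))

def Th (D : Finset (Site × Site)) (β : ℝ) (S : Finset Site) (a : Site → ℝ) : ENNReal :=
  ∑' n : LatS S, wt D β (re n + a)

lemma wt_neg (D : Finset (Site × Site)) (β : ℝ) (u : Site → ℝ) : wt D β (-u) = wt D β u := by
  simp [wt, en_neg]

lemma wt_symm (D : Finset (Site × Site)) (β : ℝ) (u v : Site → ℝ) :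
    2 * (wt D β u * wt D β v) ≤ wt D β (u + v) + wt D β (u - v) := by
  simp only [wt]
  rw [← ENNReal.ofReal_mul (Real.exp_pos _).le, ← ENNReal.ofReal_add (Real.exp_pos _).le (Real.exp_pos _).le]
  rw [show (2 : ENNReal) = ENNReal.ofReal 2 by simp, ← ENNReal.ofReal_mul (by norm_num)]
  apply ENNReal.ofReal_le_ofReal
  rw [en_add, en_sub, ← Real.exp_add (-β * en D u)]
  set x := -β * en D u + -β * en D v
  set y := β * (2 * bil D u v)
  have h1 : -β * (en D u + en D v + 2 * bil D u v) = x + -y := by simp only [x, y]; ring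
  have h2 : -β * (en D u + en D v - 2 * bil D u v) = x + y := by simp only [x, y]; ring
  rw [h1, h2, Real.exp_add x, Real.exp_add x]
  have h3 : 2 ≤ Real.exp (-y) + Real.exp y := by
    have := Real.add_one_le_exp (y / 2)
    have h4 : Real.exp y = Real.exp (y/2) ^ 2 := by rw [← Real.exp_nat_mul]; congr 1; push_cast; ring
    have h5 : Real.exp (-y) = Real.exp (-(y/2)) ^ 2 := by
      rw [← Real.exp_nat_mul]; congr 1; push_cast; ring
    have h6 : Real.exp (-(y/2)) * Real.exp (y/2) = 1 := by rw [← Real.exp_add]; simp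
    rw [h4, h5]
    nlinarith [sq_nonneg (Real.exp (-(y/2)) - Real.exp (y/2))]
  nlinarith [Real.exp_pos x]

/-- T1 -/
lemma Th_shift_ge (D : Finset (Site × Site)) (β : ℝ) (S : Finset Site) (a : Site → ℝ) :
    wt D β a * Th D β S 0 ≤ Th D β S a := by
  have h2 : 2 * (wt D β a * Th D β S 0) ≤ 2 * Th D β S a := by
    have e : Th D β S a = ∑' n : LatS S, wt D β (a - re n) := by
      rw [Th, ← (Equiv.neg (LatS S)).tsum_eq]
      refine tsum_congr fun n => ?_
      congr 1
      simp [re_neg]; abel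
    calc 2 * (wt D β a * Th D β S 0) = ∑' n : LatS S, 2 * (wt D β a * wt D β (re n)) := by
          simp only [Th, ENNReal.tsum_mul_left, add_zero]
      _ ≤ ∑' n : LatS S, (wt D β (a + re n) + wt D β (a - re n)) :=
          ENNReal.tsum_le_tsum fun n => wt_symm _ _ _ _
      _ = Th D β S a + Th D β S a := by
          rw [ENNReal.tsum_add, ← e]; simp only [Th, add_comm]
      _ = _ := by ring
  exact (ENNReal.mul_le_mul_iff_right (by simp) (by simp)).1 h2

/-- T8 -/
lemma Th_union (D : Finset (Site × Site)) (β : ℝ) (S T : Finset Site) (h : Disjoint S T) :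
    Th D β S 0 * Th D β T 0 ≤ Th D β (S ∪ T) 0 := by
  have h1 : Th D β S 0 * Th D β T 0 ≤ ∑' m : LatS T, Th D β S (re m) := by
    rw [mul_comm]
    nth_rewrite 1 [Th]
    rw [← ENNReal.tsum_mul_right]
    refine ENNReal.tsum_le_tsum fun m => ?_
    simpa using Th_shift_ge D β S (re m)
  refine h1.trans ?_
  simp only [Th, add_zero]
  rw [← ENNReal.tsum_prod]
  let f : LatS T × LatS S → LatS (S ∪ T) := fun p => ⟨p.2.1 + p.1.1, by
    intro x hx
    simp only [Finset.mem_union, not_or] at hx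
    simp [p.2.2 x hx.1, p.1.2 x hx.2]⟩
  have hf : Function.Injective f := by
    rintro ⟨m, n⟩ ⟨m', n'⟩ hh
    have hh : ∀ x, n.1 x + m.1 x = n'.1 x + m'.1 x := fun x => congrFun (congrArg Subtype.val hh) x
    have hx : ∀ x, n.1 x = n'.1 x ∧ m.1 x = m'.1 x := by
      intro x
      by_cases hS : x ∈ S
      · have hT := Finset.disjoint_left.1 h hS
        have := hh x
        rw [m.2 x hT, m'.2 x hT] at *
        simpa using this
      · have := hh x
        rw [n.2 x hS, n'.2 x hS] at *
        simpa using this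
    ext x
    · exact (hx x).2
    · exact (hx x).1
  have := ENNReal.tsum_comp_le_tsum_of_injective hf (fun n : LatS (S ∪ T) => wt D β (re n))
  refine le_trans (le_of_eq ?_) this
  refine tsum_congr fun p => ?_
  simp [f, re_add]

def Bit (S : Finset Site) : Type := {s : LatS S // ∀ x, s.1 x = 0 ∨ s.1 x = 1}

def latEquiv (S : Finset Site) : Bit S × (LatS S × LatS S) ≃ LatS S × LatS S where
  toFun p := (p.1.1 + p.2.1 + p.2.2, p.2.1 - p.2.2)
  invFun q := (⟨⟨fun x => (q.1.1 x + q.2.1 x) % 2, by intro x hx; simp [q.1.2 x hx, q.2.2 x hx]⟩,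
      by intro x; dsimp only; omega⟩,
    (⟨fun x => (q.1.1 x + q.2.1 x) / 2, by intro x hx; simp [q.1.2 x hx, q.2.2 x hx]⟩,
     ⟨fun x => (q.1.1 x + q.2.1 x) / 2 - q.2.1 x, by intro x hx; simp [q.1.2 x hx, q.2.2 x hx]⟩))
  left_inv := by
    rintro ⟨⟨s, hs⟩, u, v⟩
    refine Prod.ext (Subtype.ext (Subtype.ext (funext fun x => ?_))) (Prod.ext (Subtype.ext (funext fun x => ?_)) (Subtype.ext (funext fun x => ?_)))
    all_goals
      have := hs x
      simp
      omega
  right_inv := by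
    rintro ⟨n, m⟩
    refine Prod.ext (Subtype.ext (funext fun x => ?_)) (Subtype.ext (funext fun x => ?_))
    all_goals
      simp
      try omega

def Fs (D : Finset (Site × Site)) (β : ℝ) (S : Finset Site) (s : Bit S) (a : Site → ℝ) : ENNReal :=
  ∑' u : LatS S, wt D (β / 2) (re s.1.1 + (2 : ℝ) • re u.1 + a)

lemma Th_mul (D : Finset (Site × Site)) (β : ℝ) (S : Finset Site) (a b : Site → ℝ) :
    Th D β S a * Th D β S b = ∑' s : Bit S, Fs D β S s (a + b) * Fs D β S s (a - b) := by
  have h1 : Th D β S a * Th D β S b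
      = ∑' p : LatS S × LatS S, wt D β (re p.1 + a) * wt D β (re p.2 + b) := by
    rw [ENNReal.tsum_prod']
    simp only [ENNReal.tsum_mul_left, ENNReal.tsum_mul_right, Th]
  rw [h1, ← (latEquiv S).tsum_eq, ENNReal.tsum_prod']
  refine tsum_congr fun s => ?_
  have h2 : Fs D β S s (a + b) * Fs D β S s (a - b)
      = ∑' p : LatS S × LatS S, wt D (β / 2) (re s.1.1 + (2 : ℝ) • re p.1.1 + (a + b)) *
          wt D (β / 2) (re s.1.1 + (2 : ℝ) • re p.2.1 + (a - b)) := by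
    rw [ENNReal.tsum_prod']
    simp only [ENNReal.tsum_mul_left, ENNReal.tsum_mul_right, Fs]
  rw [h2]
  refine tsum_congr fun p => ?_
  simp only [wt]
  rw [← ENNReal.ofReal_mul (Real.exp_pos _).le, ← ENNReal.ofReal_mul (Real.exp_pos _).le,
    ← Real.exp_add, ← Real.exp_add]
  congr 2
  simp only [en, Finset.mul_sum, ← Finset.sum_add_distrib]
  refine Finset.sum_congr rfl fun e _ => ?_
  simp [latEquiv, re]
  ring

lemma ennreal_amgm (x y : ENNReal) : 2 * (x * y) ≤ x * x + y * y := by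
  rcases le_total x y with h | h
  · obtain ⟨d, rfl⟩ := le_iff_exists_add.1 h
    calc 2 * (x * (x + d)) ≤ 2 * (x * (x + d)) + d * d := le_self_add
      _ = _ := by ring
  · obtain ⟨d, rfl⟩ := le_iff_exists_add.1 h
    calc 2 * ((y + d) * y) ≤ 2 * ((y + d) * y) + d * d := le_self_add
      _ = _ := by ring

/-- T2 -/
lemma Th_double (D : Finset (Site × Site)) (β : ℝ) (S : Finset Site) (a b : Site → ℝ) :
    2 * (Th D β S a * Th D β S b) ≤ Th D β S 0 * (Th D β S (a + b) + Th D β S (a - b)) := by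
  have h := Th_mul D β S (a + b) 0
  have h' := Th_mul D β S (a - b) 0
  simp only [add_zero, sub_zero] at h h'
  rw [mul_add, mul_comm (Th D β S 0), mul_comm (Th D β S 0), h, h', Th_mul, ← ENNReal.tsum_mul_left,
    ← ENNReal.tsum_add]
  exact ENNReal.tsum_le_tsum fun s => ennreal_amgm _ _

def Supp (S : Finset Site) (u : Site → ℝ) : Prop := ∀ x ∉ S, u x = 0

def Coer (D : Finset (Site × Site)) (S : Finset Site) : Prop :=
  ∃ c > 0, ∀ u, Supp S u → c * ∑ x ∈ S, u x ^ 2 ≤ en D u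

lemma Coer.mono {D : Finset (Site × Site)} {S T : Finset Site} (h : S ⊆ T) (hT : Coer D T) :
    Coer D S := by
  obtain ⟨c, hc, H⟩ := hT
  refine ⟨c, hc, fun u hu => le_trans ?_ (H u fun x hx => hu x fun h' => hx (h h'))⟩
  gcongr

lemma summable_int_gauss (c : ℝ) (hc : 0 < c) :
    ∑' k : ℤ, ENNReal.ofReal (Real.exp (-c * (k : ℝ) ^ 2)) ≠ ⊤ := by
  have hs : Summable (fun n : ℕ => Real.exp (-c * (n : ℝ) ^ 2)) := by
    refine Summable.of_nonneg_of_le (fun _ => (Real.exp_pos _).le) (fun n => ?_)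
      (Real.summable_exp_nat_mul_iff.2 (neg_lt_zero.2 hc))
    apply Real.exp_le_exp.2
    rcases Nat.eq_zero_or_pos n with rfl | hn
    · simp
    · have : (1 : ℝ) ≤ n := by exact_mod_cast hn
      nlinarith [mul_nonneg hc.le (mul_nonneg (by linarith : (0:ℝ) ≤ n) (by linarith : (0:ℝ) ≤ n - 1))]
  have : Summable (fun k : ℤ => Real.exp (-c * (k : ℝ) ^ 2)) := by
    apply Summable.of_nat_of_neg
    · simpa using hs
    · simpa using hs
  rw [← ENNReal.ofReal_tsum_of_nonneg (fun _ => (Real.exp_pos _).le) this]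
  exact ENNReal.ofReal_ne_top

lemma gauss_lat_finite (c : ℝ) (hc : 0 < c) (S : Finset Site) :
    ∑' n : LatS S, ENNReal.ofReal (Real.exp (-c * ∑ x ∈ S, (n.1 x : ℝ) ^ 2)) ≠ ⊤ := by
  induction S using Finset.induction_on with
  | empty =>
    have : Subsingleton (LatS ∅) := ⟨fun a b => Subtype.ext (funext fun x => by
      rw [a.2 x (by simp), b.2 x (by simp)])⟩
    have : Finite (LatS ∅) := inferInstance
    have := Fintype.ofFinite (LatS ∅)
    rw [tsum_fintype]
    simp
  | insert x S hx ih =>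
    let f : LatS (insert x S) → ℤ × LatS S := fun n => (n.1 x, ⟨fun y => if y = x then 0 else n.1 y, by
      intro y hy
      by_cases h : y = x
      · simp [h]
      · simp [h]; exact n.2 y (by simp [h, hy])⟩)
    have hf : Function.Injective f := by
      intro n m h
      have h1 : n.1 x = m.1 x := congrArg Prod.fst h
      have h2 : ∀ y, (if y = x then 0 else n.1 y) = if y = x then 0 else m.1 y := fun y =>
        congrFun (congrArg (fun p : ℤ × LatS S => p.2.1) h) y
      ext y
      by_cases hy : y = x
      · rw [hy, h1]
      · simpa [hy] using h2 y
    have := ENNReal.tsum_comp_le_tsum_of_injective hf (fun p : ℤ × LatS S =>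
      ENNReal.ofReal (Real.exp (-c * (p.1 : ℝ) ^ 2)) *
        ENNReal.ofReal (Real.exp (-c * ∑ x ∈ S, (p.2.1 x : ℝ) ^ 2)))
    refine ne_top_of_le_ne_top ?_ (le_trans (le_of_eq ?_) this)
    · rw [ENNReal.tsum_prod']
      simp only [ENNReal.tsum_mul_left, ENNReal.tsum_mul_right]
      exact ENNReal.mul_ne_top (summable_int_gauss c hc) ih
    · refine tsum_congr fun n => ?_
      rw [← ENNReal.ofReal_mul (Real.exp_pos _).le, ← Real.exp_add, Finset.sum_insert hx]
      congr 2
      rw [mul_add]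
      congr 2
      refine Finset.sum_congr rfl fun y hy => ?_
      have : y ≠ x := fun h => hx (h ▸ hy)
      simp [f, this]

lemma Th_translate (D : Finset (Site × Site)) (β : ℝ) (S : Finset Site) (a : Site → ℝ) (m : LatS S) :
    Th D β S (re m + a) = Th D β S a := by
  rw [Th, Th, ← (Equiv.addRight m).tsum_eq (fun n : LatS S => wt D β (re n + a))]
  refine tsum_congr fun n => ?_
  congr 1
  simp [re_add]; abel

lemma Th_bdd (D : Finset (Site × Site)) (β : ℝ) (hβ : 0 < β) (S : Finset Site) (hS : Coer D S) :
    ∃ C : ENNReal, C ≠ ⊤ ∧ ∀ a, Supp S a → Th D β S a ≤ C := by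
  obtain ⟨c, hc, H⟩ := hS
  refine ⟨ENNReal.ofReal (Real.exp (β * c * S.card)) *
    ∑' n : LatS S, ENNReal.ofReal (Real.exp (-(β * c / 2) * ∑ x ∈ S, (n.1 x : ℝ) ^ 2)),
    ENNReal.mul_ne_top ENNReal.ofReal_ne_top (gauss_lat_finite _ (by positivity) S), fun a ha => ?_⟩
  let fl : LatS S := ⟨fun x => ⌊a x⌋, fun x hx => by simp [ha x hx]⟩
  let fr : Site → ℝ := fun x => Int.fract (a x)
  have e : a = re fl + fr := by ext x; simp [fl, fr, re]
  rw [e, Th_translate, Th, ← ENNReal.tsum_mul_left]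
  refine ENNReal.tsum_le_tsum fun n => ?_
  rw [wt, ← ENNReal.ofReal_mul (Real.exp_pos _).le, ← Real.exp_add]
  apply ENNReal.ofReal_le_ofReal
  apply Real.exp_le_exp.2
  have h1 := H (re n + fr) (fun x hx => by simp [re, fr, n.2 x hx, ha x hx])
  have h2 : (1/2 : ℝ) * (∑ x ∈ S, (n.1 x : ℝ) ^ 2) - S.card ≤ ∑ x ∈ S, (re n + fr) x ^ 2 := by
    have : (S.card : ℝ) = ∑ x ∈ S, (1 : ℝ) := by simp
    rw [this, Finset.mul_sum, ← Finset.sum_sub_distrib]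
    refine Finset.sum_le_sum fun x _ => ?_
    simp only [re, fr, Pi.add_apply]
    have h3 := Int.fract_nonneg (a x)
    have h4 := (Int.fract_lt_one (a x)).le
    nlinarith [sq_nonneg ((n.1 x : ℝ) + 2 * Int.fract (a x))]
  have h5 := mul_le_mul_of_nonneg_left (le_trans (mul_le_mul_of_nonneg_left h2 hc.le) h1) hβ.le
  nlinarith

lemma wt_pos (D : Finset (Site × Site)) (β : ℝ) (u : Site → ℝ) : 0 < wt D β u := by
  simp [wt, Real.exp_pos]

lemma Th_pos (D : Finset (Site × Site)) (β : ℝ) (S : Finset Site) (a : Site → ℝ) : 0 < Th D β S a :=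
  lt_of_lt_of_le (wt_pos D β (re (0 : LatS S) + a)) (ENNReal.le_tsum (f := fun n : LatS S => wt D β (re n + a)) (0 : LatS S))

/-- T4 -/
lemma Th_le_zero (D : Finset (Site × Site)) (β : ℝ) (hβ : 0 < β) (S : Finset Site) (hS : Coer D S)
    (a : Site → ℝ) (ha : Supp S a) : Th D β S a ≤ Th D β S 0 := by
  obtain ⟨C, hC, H⟩ := Th_bdd D β hβ S hS
  have fin : ∀ a, Supp S a → Th D β S a ≠ ⊤ := fun a ha => ne_top_of_le_ne_top hC (H a ha)
  have s0 : Supp S 0 := fun x _ => rfl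
  let R : Set ℝ := {t | ∃ a, Supp S a ∧ t = (Th D β S a).toReal}
  have hR : BddAbove R := ⟨C.toReal, by rintro _ ⟨a, ha, rfl⟩; exact ENNReal.toReal_mono hC (H a ha)⟩
  set m := sSup R
  set t0 := (Th D β S 0).toReal
  have ht0 : 0 ≤ t0 := ENNReal.toReal_nonneg
  have hm : t0 ≤ m := le_csSup hR ⟨0, s0, rfl⟩
  have key : ∀ t ∈ R, t ≤ Real.sqrt (t0 * (m + t0) / 2) := by
    rintro _ ⟨a, ha, rfl⟩
    apply Real.le_sqrt_of_sq_le
    have h := Th_double D β S a a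
    have h2a : Supp S (a + a) := fun x hx => by simp [ha x hx]
    have h' := ENNReal.toReal_mono (ENNReal.mul_ne_top (fin 0 s0) (ENNReal.add_ne_top.2
      ⟨fin _ h2a, fin _ (fun x hx => by simp)⟩)) h
    rw [sub_self, ENNReal.toReal_mul, ENNReal.toReal_mul, ENNReal.toReal_mul,
      ENNReal.toReal_add (fin _ h2a) (fin 0 s0)] at h'
    have : (Th D β S (a + a)).toReal ≤ m := le_csSup hR ⟨_, h2a, rfl⟩
    simp only [ENNReal.toReal_ofNat] at h'
    have h6 : t0 * ((Th D β S (a + a)).toReal + t0) ≤ t0 * (m + t0) := by gcongr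
    nlinarith
  have hm2 : m ≤ Real.sqrt (t0 * (m + t0) / 2) := csSup_le ⟨_, 0, s0, rfl⟩ key
  have hm3 : m ^ 2 ≤ t0 * (m + t0) / 2 := by
    have hm0 : 0 ≤ m := ht0.trans hm
    have h0 : 0 ≤ t0 * (m + t0) / 2 := by positivity
    calc m ^ 2 ≤ (Real.sqrt (t0 * (m + t0) / 2)) ^ 2 := by gcongr
      _ = _ := Real.sq_sqrt h0
  have t0pos : 0 < t0 := ENNReal.toReal_pos (Th_pos D β S 0).ne' (fin 0 s0)
  have hmt : m ≤ t0 := by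
    by_contra hlt
    push Not at hlt
    nlinarith [mul_pos (sub_pos.2 hlt) (by linarith : 0 < 2 * m + t0)]
  exact (ENNReal.toReal_le_toReal (fin a ha) (fin 0 s0)).1 ((le_csSup hR ⟨a, ha, rfl⟩).trans hmt)

def extS (S : Finset Site) : (S → ℝ) →ₗ[ℝ] (Site → ℝ) where
  toFun g := fun x => if h : x ∈ S then g ⟨x, h⟩ else 0
  map_add' := by intro a b; ext x; by_cases h : x ∈ S <;> simp [h]
  map_smul' := by intro a b; ext x; by_cases h : x ∈ S <;> simp [h]

def bilL (D : Finset (Site × Site)) : (Site → ℝ) →ₗ[ℝ] (Site → ℝ) →ₗ[ℝ] ℝ :=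
  LinearMap.mk₂ ℝ (bil D)
    (by intro a b c; simp only [bil, ← Finset.sum_add_distrib]
        exact Finset.sum_congr rfl fun e _ => by simp only [Pi.add_apply]; ring)
    (by intro t b c; simp only [bil, Finset.smul_sum]
        exact Finset.sum_congr rfl fun e _ => by simp only [Pi.smul_apply, smul_eq_mul]; ring)
    (by intro a b c; simp only [bil, ← Finset.sum_add_distrib]
        exact Finset.sum_congr rfl fun e _ => by simp only [Pi.add_apply]; ring)
    (by intro t b c; simp only [bil, Finset.smul_sum]
        exact Finset.sum_congr rfl fun e _ => by simp only [Pi.smul_apply, smul_eq_mul]; ring)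

lemma bilL_apply (D : Finset (Site × Site)) (u v) : bilL D u v = bil D u v := rfl

lemma extS_supp (S : Finset Site) (g : S → ℝ) : Supp S (extS S g) := fun x hx => by simp [extS, hx]

/-- T5 -/
lemma exists_harmonic (D : Finset (Site × Site)) (S : Finset Site) (hS : Coer D S) (d : Site → ℝ) :
    ∃ g, Supp S g ∧ ∀ v, Supp S v → bil D (d + g) v = 0 := by
  obtain ⟨c, hc, H⟩ := hS
  let Φ : (S → ℝ) →ₗ[ℝ] Module.Dual ℝ (S → ℝ) := ((bilL D).compl₁₂ (extS S) (extS S))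
  have hΦ : ∀ g v, Φ g v = bil D (extS S g) (extS S v) := fun g v => rfl
  have inj : Function.Injective Φ := by
    rw [← LinearMap.ker_eq_bot, LinearMap.ker_eq_bot']
    intro g hg
    have h1 : en D (extS S g) = 0 := by
      have : Φ g g = 0 := by rw [hg]; rfl
      rw [hΦ] at this
      rw [← this]; simp [en, bil, sq]
    have h2 := H _ (extS_supp S g)
    rw [h1] at h2
    have h3 : ∑ x ∈ S, (extS S g) x ^ 2 = 0 :=
      le_antisymm (by nlinarith) (Finset.sum_nonneg fun _ _ => sq_nonneg _)
    rw [Finset.sum_eq_zero_iff_of_nonneg (fun _ _ => sq_nonneg _)] at h3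
    ext ⟨x, hx⟩
    have := h3 x hx
    simpa [extS, hx] using this
  have surj : Function.Surjective Φ :=
    (LinearMap.injective_iff_surjective_of_finrank_eq_finrank Subspace.dual_finrank_eq.symm).1 inj
  obtain ⟨g, hg⟩ := surj (-(bilL D d).comp (extS S))
  refine ⟨extS S g, extS_supp S g, fun v hv => ?_⟩
  have hv' : v = extS S (fun x => v x.1) := by
    ext x
    by_cases hx : x ∈ S
    · simp [extS, hx]
    · simp [extS, hx, hv x hx]
  have h := LinearMap.congr_fun hg (fun x => v x.1)
  rw [hΦ, ← hv'] at h
  simp only [LinearMap.neg_apply, LinearMap.comp_apply, ← hv'] at h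
  rw [← bilL_apply, map_add, LinearMap.add_apply, bilL_apply D (extS S g), h]
  simp

/-- T6 -/
lemma Th_cap (D : Finset (Site × Site)) (β : ℝ) (hβ : 0 < β) (S : Finset Site) (hS : Coer D S)
    (d : Site → ℝ) (t κ : ℝ) (hκ : ∀ g, Supp S g → κ ≤ en D (d + g)) :
    Th D β S (t • d) ≤ ENNReal.ofReal (Real.exp (-β * (t ^ 2 * κ))) * Th D β S 0 := by
  obtain ⟨g, hg, hh⟩ := exists_harmonic D S hS d
  have h1 : Supp S (-(t • g)) := fun x hx => by simp [hg x hx]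
  refine le_trans ?_ (mul_le_mul_right (Th_le_zero D β hβ S hS _ h1) _)
  rw [Th, Th, ← ENNReal.tsum_mul_left]
  refine ENNReal.tsum_le_tsum fun n => ?_
  rw [wt, wt, ← ENNReal.ofReal_mul (Real.exp_pos _).le, ← Real.exp_add]
  apply ENNReal.ofReal_le_ofReal
  apply Real.exp_le_exp.2
  have e : re n + t • d = t • (d + g) + (re n + -(t • g)) := by rw [smul_add]; abel
  have h2 : Supp S (re n + -(t • g)) := fun x hx => by simp [hg x hx, re, n.2 x hx]
  have h3 : bil D (t • (d + g)) (re n + -(t • g)) = 0 := by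
    rw [← bilL_apply, map_smul, LinearMap.smul_apply, bilL_apply, hh _ h2, smul_zero]
  rw [e, en_add, h3, en_smul]
  have := mul_le_mul_of_nonneg_left (hκ g hg) (mul_nonneg hβ.le (sq_nonneg t))
  nlinarith

def Bx (M : ℕ) : Finset Site := Finset.Icc (-(M : ℤ)) M ×ˢ Finset.Icc (-(M : ℤ)) M

lemma mem_Bx {M : ℕ} {x : Site} : x ∈ Bx M ↔ (-(M : ℤ) ≤ x.1 ∧ x.1 ≤ M) ∧ (-(M : ℤ) ≤ x.2 ∧ x.2 ≤ M) := by
  simp [Bx]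

def nxt (x y : Site) : Prop := y = (x.1 + 1, x.2) ∨ y = (x.1, x.2 + 1)

def Dg (M : ℕ) : Finset (Site × Site) := (Bx M ×ˢ Bx M).filter (fun p => nxt p.1 p.2)

lemma mem_Dg {M : ℕ} {p : Site × Site} : p ∈ Dg M ↔ (p.1 ∈ Bx M ∧ p.2 ∈ Bx M) ∧ nxt p.1 p.2 := by
  simp [Dg]

lemma coer_Dg (M : ℕ) (S : Finset Site) (hS : S ⊆ Bx M) : Coer (Dg (M + 1)) S := by
  refine ⟨1 / ((2 * M + 2) * (S.card + 1)), by positivity, fun u hu => ?_⟩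
  have h1 : ∀ x ∈ S, u x ^ 2 ≤ (2 * M + 2) * en (Dg (M + 1)) u := by
    intro x hx
    have hb := mem_Bx.1 (hS hx)
    obtain ⟨K, hK⟩ : ∃ K : ℕ, (K : ℤ) = M + 1 - x.1 := ⟨(M + 1 - x.1).toNat, by omega⟩
    have hK2 : K ≤ 2 * M + 2 := by omega
    let v : ℕ → ℝ := fun k => u (x.1 + k, x.2)
    have v0 : v 0 = u x := by simp [v]
    have vK : v K = 0 := by
      apply hu
      intro h
      have := mem_Bx.1 (hS h)
      simp at this; omega
    have h2 : u x = ∑ k ∈ Finset.range K, (v k - v (k + 1)) := by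
      rw [Finset.sum_range_sub', v0, vK, sub_zero]
    have h3 : ∑ k ∈ Finset.range K, (v k - v (k + 1)) ^ 2 ≤ en (Dg (M + 1)) u := by
      let e : ℕ → Site × Site := fun k => ((x.1 + k, x.2), (x.1 + (k + 1 : ℕ), x.2))
      have he : Function.Injective e := by
        intro a b h; simp [e] at h; omega
      have : ∑ k ∈ Finset.range K, (v k - v (k + 1)) ^ 2
          = ∑ p ∈ (Finset.range K).image e, (u p.1 - u p.2) ^ 2 := by
        rw [Finset.sum_image (fun a _ b _ h => he h)]
      rw [this, en]
      refine Finset.sum_le_sum_of_subset_of_nonneg ?_ fun _ _ _ => sq_nonneg _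
      intro p hp
      obtain ⟨k, hk, rfl⟩ := Finset.mem_image.1 hp
      have := Finset.mem_range.1 hk
      rw [mem_Dg, mem_Bx, mem_Bx]
      refine ⟨⟨?_, ?_⟩, Or.inl ?_⟩
      · simp [e]; omega
      · simp [e]; omega
      · simp [e]; ring
    rw [h2]
    calc _ ≤ ((Finset.range K).card : ℝ) * ∑ k ∈ Finset.range K, (v k - v (k + 1)) ^ 2 :=
          sq_sum_le_card_mul_sum_sq
      _ ≤ (2 * M + 2) * en (Dg (M + 1)) u := by
          gcongr
          rw [Finset.card_range]; exact_mod_cast hK2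
  have h4 : ∑ x ∈ S, u x ^ 2 ≤ S.card * ((2 * M + 2) * en (Dg (M + 1)) u) := by
    simpa using Finset.sum_le_card_nsmul S _ _ h1
  have h5 := en_nonneg (Dg (M + 1)) u
  rw [one_div, inv_mul_le_iff₀ (by positivity)]
  nlinarith

lemma dgH_eq (M : ℕ) (η : Site → ℤ) (hη : ∀ x ∉ Bx M, η x = 0) : dgH η = en (Dg (M + 1)) (re η) := by
  have h0 : ∀ p ∉ Dg (M + 1) ∪ (Dg (M + 1)).image Prod.swap,
      (if adjP p.1 p.2 then ((η p.1 - η p.2 : ℤ) : ℝ) ^ 2 else 0) = 0 := by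
    rintro ⟨⟨a, b⟩, ⟨c, d⟩⟩ hp
    simp only [Finset.mem_union, Finset.mem_image, not_or] at hp
    split_ifs with h
    · by_cases h1 : (a, b) ∈ Bx (M + 1) ∧ (c, d) ∈ Bx (M + 1)
      · exfalso
        have hh : nxt (a, b) (c, d) ∨ nxt (c, d) (a, b) := by
          simp only [adjP] at h
          simp only [nxt, Prod.mk.injEq]
          grind
        rcases hh with hh | hh
        · exact hp.1 (mem_Dg.2 ⟨h1, hh⟩)
        · exact hp.2 ⟨((c, d), (a, b)), mem_Dg.2 ⟨h1.symm, hh⟩, rfl⟩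
      · have h2 : (a, b) ∉ Bx M ∧ (c, d) ∉ Bx M := by
          simp only [mem_Bx] at h1 ⊢
          simp only [adjP] at h
          push_cast at h1
          grind
        simp [hη _ h2.1, hη _ h2.2]
    · rfl
  rw [dgH, tsum_eq_sum h0, Finset.sum_union]
  · have ha : ∀ p ∈ Dg (M + 1), adjP p.1 p.2 ∧ adjP p.2 p.1 := by
      intro p hp
      have := (mem_Dg.1 hp).2
      simp only [nxt] at this
      simp only [adjP]
      rcases this with h | h <;> rw [h] <;> simp
    rw [Finset.sum_image (fun a _ b _ h => Prod.swap_injective h), ← Finset.sum_add_distrib,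
      Finset.mul_sum, en]
    refine Finset.sum_congr rfl fun p hp => ?_
    simp only [Prod.fst_swap, Prod.snd_swap, ha p hp, if_true, re]
    push_cast; ring
  · rw [Finset.disjoint_left]
    rintro ⟨⟨a, b⟩, ⟨c, d⟩⟩ hp hq
    have h1 := (mem_Dg.1 hp).2
    obtain ⟨⟨⟨a', b'⟩, ⟨c', d'⟩⟩, hq, he⟩ := Finset.mem_image.1 hq
    have h2 := (mem_Dg.1 hq).2
    clear hp hq h0
    simp only [nxt, Prod.swap_prod_mk, Prod.mk.injEq] at h1 h2 he
    omega

def dl : Site → ℝ := fun x => if x = (0, 0) then 1 else 0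

def ind (D : Finset (Site × Site)) (β : ℝ) (Λ : Finset Site) (b k : ℤ) (η : Site → ℤ) : ℝ :=
  if (∀ x ∉ Λ, η x = b) ∧ η (0, 0) = k then Real.exp (-β * en D (re η)) else 0

lemma ind_nonneg (D : Finset (Site × Site)) (β : ℝ) (Λ : Finset Site) (b k : ℤ) (η : Site → ℤ) :
    0 ≤ ind D β Λ b k η := by
  unfold ind; split_ifs <;> positivity

lemma Th_eq_full (D : Finset (Site × Site)) (β : ℝ) (Λ : Finset Site) (h0 : (0, 0) ∈ Λ) (k : ℤ) :
    Th D β (Λ.erase (0, 0)) ((k : ℝ) • dl) = ∑' η : Site → ℤ, ENNReal.ofReal (ind D β Λ 0 k η) := by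
  let dz : Site → ℤ := fun x => if x = (0, 0) then 1 else 0
  let g : LatS (Λ.erase (0, 0)) → (Site → ℤ) := fun n => n.1 + k • dz
  have hg : Function.Injective g := fun a b h => Subtype.ext (add_right_cancel h)
  rw [← hg.tsum_eq]
  · rw [Th]
    refine tsum_congr fun n => ?_
    have h1 : (∀ x ∉ Λ, g n x = 0) ∧ g n (0, 0) = k := by
      refine ⟨fun x hx => ?_, ?_⟩
      · have hx0 : x ≠ (0, 0) := fun h => hx (h ▸ h0)
        simp only [g, dz, Pi.add_apply, Pi.smul_apply, if_neg hx0]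
        rw [n.2 x (fun h => hx (Finset.mem_of_mem_erase h))]; simp
      · simp only [g, dz, Pi.add_apply, Pi.smul_apply]
        rw [n.2 (0, 0) (by simp)]; simp
    rw [ind, if_pos h1, wt]
    congr 5
    ext x
    simp [re, g, dz, dl]
  · intro η hη
    have h1 : (∀ x ∉ Λ, η x = 0) ∧ η (0, 0) = k := by
      by_contra h
      apply hη
      show ENNReal.ofReal (ind D β Λ 0 k η) = 0
      rw [ind, if_neg h, ENNReal.ofReal_zero]
    refine ⟨⟨η - k • dz, ?_⟩, by simp [g]⟩
    intro x hx
    by_cases hx0 : x = (0, 0)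
    · simp [hx0, dz, h1.2]
    · simp [hx0, dz, h1.1 x (fun h => hx (Finset.mem_erase.2 ⟨hx0, h⟩))]

lemma dgW_eq (M : ℕ) (β : ℝ) (Λ : Finset Site) (hΛ : Λ ⊆ Bx M) (h0 : (0, 0) ∈ Λ) (k : ℤ) :
    dgW β Λ (fun η => η (0, 0) = k) =
      (Th (Dg (M + 1)) β (Λ.erase (0, 0)) ((k : ℝ) • dl)).toReal := by
  rw [Th_eq_full _ _ _ h0, ENNReal.tsum_toReal_eq (fun _ => ENNReal.ofReal_ne_top), dgW]
  refine tsum_congr fun η => ?_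
  rw [ENNReal.toReal_ofReal (ind_nonneg _ _ _ _ _ _), ind]
  split_ifs with h
  · rw [dgH_eq M η (fun x hx => h.1 x (fun h' => hx (hΛ h')))]
  · rfl

lemma dgW_true (M : ℕ) (β : ℝ) (hβ : 0 < β) (Λ : Finset Site) (hΛ : Λ ⊆ Bx M) :
    0 < dgW β Λ (fun _ => True) := by
  have h1 : dgW β Λ (fun _ => True) = (Th (Dg (M + 1)) β Λ 0).toReal := by
    rw [Th, ENNReal.tsum_toReal_eq (fun _ => by rw [wt]; exact ENNReal.ofReal_ne_top), dgW]
    have hg : Function.Injective (fun n : LatS Λ => n.1) := Subtype.val_injective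
    rw [← hg.tsum_eq]
    · refine tsum_congr fun n => ?_
      rw [if_pos ⟨n.2, trivial⟩, wt, ENNReal.toReal_ofReal (Real.exp_pos _).le, add_zero,
        dgH_eq M n.1 (fun x hx => n.2 x (fun h' => hx (hΛ h')))]
    · intro η hη
      refine ⟨⟨η, ?_⟩, rfl⟩
      by_contra h
      apply hη
      exact if_neg (fun hh => h hh.1)
  rw [h1]
  obtain ⟨C, hC, H⟩ := Th_bdd (Dg (M + 1)) β hβ Λ (coer_Dg M Λ hΛ)
  exact ENNReal.toReal_pos (Th_pos _ _ _ _).ne' (ne_top_of_le_ne_top hC (H 0 (fun _ _ => rfl)))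

lemma minmax_sq (a b c d : ℝ) :
    (min a b - min c d) ^ 2 + (max a b - max c d) ^ 2 ≤ (a - c) ^ 2 + (b - d) ^ 2 := by
  rcases le_total a b with h | h <;> rcases le_total c d with h' | h' <;>
    simp only [min_eq_left, min_eq_right, max_eq_left, max_eq_right, h, h'] <;>
    nlinarith [mul_nonneg (sub_nonneg.2 h) (sub_nonneg.2 h')]

lemma en_lattice (D : Finset (Site × Site)) (a b : Site → ℤ) :
    en D (re (a ⊓ b)) + en D (re (a ⊔ b)) ≤ en D (re a) + en D (re b) := by
  simp only [en, ← Finset.sum_add_distrib]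
  refine Finset.sum_le_sum fun e _ => ?_
  simp only [re, Pi.inf_apply, Pi.sup_apply]
  push_cast
  exact minmax_sq _ _ _ _

lemma ind_four (D : Finset (Site × Site)) (β : ℝ) (hβ : 0 < β) (Λ : Finset Site) (k : ℤ)
    (a b : Site → ℤ) : ind D β Λ 0 (k + 1) a * ind D β Λ 1 k b ≤
      ind D β Λ 0 k (a ⊓ b) * ind D β Λ 1 (k + 1) (a ⊔ b) := by
  by_cases h1 : (∀ x ∉ Λ, a x = 0) ∧ a (0, 0) = k + 1
  · by_cases h2 : (∀ x ∉ Λ, b x = 1) ∧ b (0, 0) = k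
    · have h3 : (∀ x ∉ Λ, (a ⊓ b) x = 0) ∧ (a ⊓ b) (0, 0) = k :=
        ⟨fun x hx => by simp [h1.1 x hx, h2.1 x hx], by simp [h1.2, h2.2]⟩
      have h4 : (∀ x ∉ Λ, (a ⊔ b) x = 1) ∧ (a ⊔ b) (0, 0) = k + 1 :=
        ⟨fun x hx => by simp [h1.1 x hx, h2.1 x hx], by simp [h1.2, h2.2]⟩
      rw [ind, ind, ind, ind, if_pos h1, if_pos h2, if_pos h3, if_pos h4, ← Real.exp_add,
        ← Real.exp_add]
      apply Real.exp_le_exp.2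
      have := mul_le_mul_of_nonneg_left (en_lattice D a b) hβ.le
      nlinarith
    · have : ind D β Λ 1 k b = 0 := by rw [ind, if_neg h2]
      rw [this, mul_zero]
      exact mul_nonneg (ind_nonneg _ _ _ _ _ _) (ind_nonneg _ _ _ _ _ _)
  · have : ind D β Λ 0 (k + 1) a = 0 := by rw [ind, if_neg h1]
    rw [this, zero_mul]
    exact mul_nonneg (ind_nonneg _ _ _ _ _ _) (ind_nonneg _ _ _ _ _ _)

lemma ind_shift (D : Finset (Site × Site)) (β : ℝ) (Λ : Finset Site) (k : ℤ) :
    ∑' η : Site → ℤ, ENNReal.ofReal (ind D β Λ 1 (k + 1) η) =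
      ∑' η : Site → ℤ, ENNReal.ofReal (ind D β Λ 0 k η) := by
  rw [← (Equiv.addRight (1 : Site → ℤ)).tsum_eq]
  refine tsum_congr fun η => ?_
  simp only [ind, Equiv.coe_addRight, Pi.add_apply, Pi.one_apply]
  have : en D (re (η + 1)) = en D (re η) := by
    simp [en, re]
  rw [this]
  congr 2
  simp

/-- T7 -/
lemma Th_logconcave (D : Finset (Site × Site)) (β : ℝ) (hβ : 0 < β) (Λ : Finset Site)
    (h0 : (0, 0) ∈ Λ) (k : ℤ) :
    Th D β (Λ.erase (0, 0)) (((k + 1 : ℤ) : ℝ) • dl) * Th D β (Λ.erase (0, 0)) (((k - 1 : ℤ) : ℝ) • dl)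
      ≤ Th D β (Λ.erase (0, 0)) ((k : ℝ) • dl) * Th D β (Λ.erase (0, 0)) ((k : ℝ) • dl) := by
  simp only [Th_eq_full _ _ _ h0]
  have e2 := ind_shift D β Λ (k - 1)
  rw [sub_add_cancel] at e2
  rw [← e2]
  nth_rewrite 2 [← ind_shift D β Λ k]
  rw [ENNReal.tsum_eq_iSup_sum, ENNReal.tsum_eq_iSup_sum, ENNReal.iSup_mul]
  refine iSup_le fun s => ?_
  rw [ENNReal.mul_iSup]
  refine iSup_le fun t => ?_
  have := four_functions_theorem (α := Site → ℤ) (β := ℝ) (f₁ := ind D β Λ 0 (k + 1)) (f₂ := ind D β Λ 1 k)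
    (f₃ := ind D β Λ 0 k) (f₄ := ind D β Λ 1 (k + 1)) (fun _ => ind_nonneg _ _ _ _ _ _)
    (fun _ => ind_nonneg _ _ _ _ _ _) (fun _ => ind_nonneg _ _ _ _ _ _)
    (fun _ => ind_nonneg _ _ _ _ _ _) (fun a b => ind_four D β hβ Λ k a b) s t
  have h := ENNReal.ofReal_le_ofReal this
  have nn : ∀ (b k : ℤ) (s : Finset (Site → ℤ)), 0 ≤ ∑ a ∈ s, ind D β Λ b k a :=
    fun _ _ _ => Finset.sum_nonneg fun _ _ => ind_nonneg _ _ _ _ _ _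
  rw [ENNReal.ofReal_mul (nn _ _ _), ENNReal.ofReal_mul (nn _ _ _)] at h
  simp only [ENNReal.ofReal_sum_of_nonneg (fun _ _ => ind_nonneg _ _ _ _ _ _)] at h
  refine h.trans (mul_le_mul' (ENNReal.sum_le_tsum _) (ENNReal.sum_le_tsum _))

def nbr (x y : Site) : Prop := nxt x y ∨ nxt y x

lemma nbr_symm {x y : Site} (h : nbr x y) : nbr y x := h.symm

def ConnS (A : Set Site) : Prop := ∀ P : Site → Prop, (∃ x ∈ A, P x) →
  (∀ x ∈ A, ∀ y ∈ A, nbr x y → P x → P y) → ∀ x ∈ A, P x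

lemma conn_univ : ConnS Set.univ := by
  rintro P ⟨⟨a, b⟩, -, h⟩ H
  have H' : ∀ x y, nbr x y → P x → P y := fun x y => H x trivial y trivial
  have h1 : ∀ n : ℤ, ∀ a b, P (a, b) → P (a + n, b) := by
    intro n
    induction n using Int.induction_on with
    | zero => intro a b h; simpa using h
    | succ i ih => intro a b h; exact H' (a + i, b) _ (Or.inl (Or.inl (by simp [add_assoc]))) (ih a b h)
    | pred i ih => intro a b h; exact H' (a + -i, b) _ (Or.inr (Or.inl (by simp; ring))) (ih a b h)
  have h2 : ∀ n : ℤ, ∀ a b, P (a, b) → P (a, b + n) := by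
    intro n
    induction n using Int.induction_on with
    | zero => intro a b h; simpa using h
    | succ i ih => intro a b h; exact H' (a, b + i) _ (Or.inl (Or.inr (by simp [add_assoc]))) (ih a b h)
    | pred i ih => intro a b h; exact H' (a, b + -i) _ (Or.inr (Or.inr (by simp; ring))) (ih a b h)
  rintro ⟨c, d⟩ -
  have := h2 (d - b) _ _ (h1 (c - a) _ _ h)
  simpa using this

def stepR (T : Set Site) (x y : Site) : Prop := nbr x y ∧ x ∈ T ∧ y ∈ T

def Comp (T : Set Site) (p : Site) : Set Site := {x | Relation.ReflTransGen (stepR T) p x}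

lemma rtg_symm {T : Set Site} {x y : Site} (h : Relation.ReflTransGen (stepR T) x y) :
    Relation.ReflTransGen (stepR T) y x := by
  induction h with
  | refl => exact .refl
  | tail _ h2 ih => exact .head ⟨nbr_symm h2.1, h2.2.2, h2.2.1⟩ ih

lemma comp_sub {T : Set Site} {p : Site} (hp : p ∈ T) : Comp T p ⊆ T := by
  intro x hx
  induction hx with
  | refl => exact hp
  | tail _ h2 _ => exact h2.2.2

lemma comp_conn (T : Set Site) (p : Site) : ConnS (Comp T p) := by
  rintro P ⟨x, hx, hPx⟩ H y hy
  have : Relation.ReflTransGen (stepR T) x y := (rtg_symm hx).trans hy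
  clear hy
  suffices h : P y ∧ y ∈ Comp T p from h.1
  induction this with
  | refl => exact ⟨hPx, hx⟩
  | tail _ h2 ih =>
    have hm := Relation.ReflTransGen.tail ih.2 h2
    exact ⟨H _ ih.2 _ hm h2.1 ih.1, hm⟩

lemma comp_step {T : Set Site} {p x y : Site} (hx : x ∈ Comp T p) (hxT : x ∈ T) (hy : y ∈ T)
    (h : nbr x y) : y ∈ Comp T p := Relation.ReflTransGen.tail hx ⟨h, hxT, hy⟩

def Good (A : Finset Site) : Prop :=
  (0, 0) ∈ A ∧ ConnS (A : Set Site) ∧ ConnS ((A : Set Site)ᶜ)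

/-- T10 -/
lemma exists_cluster (Λ : Finset Site) (p : Site) (hp : p ∉ Λ)
    (hΛ : ∀ x ∉ Λ, x ∈ Comp ((Λ : Set Site)ᶜ) p) (η : Site → ℤ) (hη : ∀ x ∉ Λ, η x = 0)
    (h0 : 1 ≤ η (0, 0)) :
    ∃ A ⊆ Λ, Good A ∧ ∀ x ∈ A, ∀ y ∉ A, nbr x y → 1 ≤ η x ∧ η y ≤ 0 := by
  set T : Set Site := {x | η x ≤ 0}
  have hpT : p ∈ T := by simp [T, hη p hp]
  set U := Comp T p
  have hUT : U ⊆ T := comp_sub hpT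
  have hΛU : ∀ x ∉ Λ, x ∈ U := by
    intro x hx
    have hh := hΛ x hx
    have hst : ∀ a b, stepR ((Λ : Set Site)ᶜ) a b → stepR T a b := by
      rintro a b ⟨h1, h2, h3⟩
      exact ⟨h1, by simp [T, hη a h2], by simp [T, hη b h3]⟩
    clear hx
    induction hh with
    | refl => exact Relation.ReflTransGen.refl
    | tail _ h2 ih => exact Relation.ReflTransGen.tail ih (hst _ _ h2)
  have h0U : (0, 0) ∈ Uᶜ := fun h => by have : η (0, 0) ≤ 0 := hUT h; omega
  set A := Comp Uᶜ (0, 0)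
  have hAU : A ⊆ Uᶜ := comp_sub h0U
  have hAΛ : A ⊆ Λ := fun x hx => by
    by_contra h; exact hAU hx (hΛU x h)
  have hfin : A.Finite := Λ.finite_toSet.subset hAΛ
  have hcU : ∀ x ∈ Uᶜ, ∀ y ∈ U, nbr x y → 1 ≤ η x := by
    intro x hx y hy h
    by_contra hlt
    exact hx (comp_step hy (hUT hy) (show η x ≤ 0 by omega) (nbr_symm h))
  refine ⟨hfin.toFinset, by simpa using hAΛ, ⟨(hfin.mem_toFinset).2 Relation.ReflTransGen.refl, by simpa using comp_conn _ _, ?_⟩, ?_⟩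
  · rw [Set.Finite.coe_toFinset]
    rintro P ⟨z, hz, hPz⟩ H
    have hUA : U ⊆ Aᶜ := fun x hx h => hAU h hx
    have hpU : p ∈ U := Relation.ReflTransGen.refl
    have hconst : ∀ y ∈ Aᶜ, (P y ↔ P p) := by
      have hU : ∀ u ∈ U, (P u ↔ P p) := by
        apply comp_conn T p (fun u => P u ↔ P p) ⟨p, hpU, Iff.rfl⟩
        intro x hx y hy h hxp
        rw [← hxp]
        exact ⟨H y (hUA hy) x (hUA hx) (nbr_symm h), H x (hUA hx) y (hUA hy) h⟩
      intro y hy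
      by_cases hyU : y ∈ U
      · exact hU y hyU
      · have hsub : Comp Uᶜ y ⊆ Uᶜ := comp_sub hyU
        have hdis : Comp Uᶜ y ⊆ Aᶜ := fun x hx hxA => hy (Relation.ReflTransGen.trans hxA (rtg_symm hx))
        obtain ⟨x, hx, u, hu, hxu⟩ : ∃ x ∈ Comp Uᶜ y, ∃ u ∈ U, nbr x u := by
          by_contra hcon
          push Not at hcon
          have := conn_univ (fun x => x ∈ Comp Uᶜ y) ⟨y, trivial, Relation.ReflTransGen.refl⟩
            (fun a _ b _ hab ha => comp_step ha (hsub ha) (fun hb => hcon a ha b hb hab) hab) p trivial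
          exact hsub this hpU
        have h1 : P y ↔ P x := by
          refine comp_conn Uᶜ y (fun w => P y ↔ P w) ⟨y, Relation.ReflTransGen.refl, Iff.rfl⟩ ?_ x hx
          intro a ha b hb hab hpa
          rw [hpa]
          exact ⟨H a (hdis ha) b (hdis hb) hab, H b (hdis hb) a (hdis ha) (nbr_symm hab)⟩
        rw [h1, ← hU u hu]
        exact ⟨H x (hdis hx) u (hUA hu) hxu, H u (hUA hu) x (hdis hx) (nbr_symm hxu)⟩
    intro x hx
    rw [hconst x hx, ← hconst z hz]; exact hPz
  · intro x hx y hy hxy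
    rw [Set.Finite.mem_toFinset] at hx hy
    have hyU : y ∈ U := by
      by_contra h
      exact hy (comp_step hx (hAU hx) h hxy)
    exact ⟨hcU x (hAU hx) y hyU hxy, hUT hyU⟩

/-- boundary edges -/
def bdE (M : ℕ) (A : Finset Site) : Finset (Site × Site) :=
  (Dg (M + 1)).filter (fun e => ¬ (e.1 ∈ A ↔ e.2 ∈ A))

def mid (e : Site × Site) : Site := e.1 + e.2

def MA (M : ℕ) (A : Finset Site) : Finset Site := (bdE M A).image mid

lemma mid_inj {e f : Site × Site} (he : nxt e.1 e.2) (hf : nxt f.1 f.2) (h : mid e = mid f) : e = f := by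
  obtain ⟨⟨a, b⟩, ⟨c, d⟩⟩ := e
  obtain ⟨⟨a', b'⟩, ⟨c', d'⟩⟩ := f
  simp only [nxt, mid, Prod.mk.injEq, Prod.mk_add_mk] at *
  omega

lemma card_MA (M : ℕ) (A : Finset Site) : (MA M A).card = (bdE M A).card := by
  apply Finset.card_image_of_injOn
  intro e he f hf h
  simp only [bdE, Finset.coe_filter, Set.mem_ofPred_eq, mem_Dg] at he hf
  exact mid_inj he.1.2 hf.1.2 h

lemma mem_MA {M : ℕ} {A : Finset Site} (hA : A ⊆ Bx M) {x y : Site} (h : nxt x y) :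
    x + y ∈ MA M A ↔ ¬ (x ∈ A ↔ y ∈ A) := by
  constructor
  · intro hm
    obtain ⟨f, hf, hmf⟩ := Finset.mem_image.1 hm
    simp only [bdE, Finset.mem_filter, mem_Dg] at hf
    have := mid_inj (e := (x, y)) (f := f) h hf.1.2 hmf.symm
    subst this
    exact hf.2
  · intro hb
    refine Finset.mem_image.2 ⟨(x, y), ?_, rfl⟩
    simp only [bdE, Finset.mem_filter, mem_Dg]
    refine ⟨⟨?_, h⟩, hb⟩
    obtain ⟨a, b⟩ := x
    obtain ⟨c, d⟩ := y
    have h1 : (a, b) ∈ Bx M ∨ (c, d) ∈ Bx M := by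
      by_contra hcon
      push Not at hcon
      exact hb ⟨fun h => absurd (hA h) hcon.1, fun h => absurd (hA h) hcon.2⟩
    simp only [mem_Bx] at *
    simp only [nxt, Prod.mk.injEq] at h
    push_cast
    omega

lemma mem_MA_h {M : ℕ} {A : Finset Site} (hA : A ⊆ Bx M) (a b : ℤ) :
    (2 * a + 1, 2 * b) ∈ MA M A ↔ ¬ ((a, b) ∈ A ↔ (a + 1, b) ∈ A) := by
  rw [← mem_MA hA (Or.inl rfl)]
  simp only [Prod.mk_add_mk]
  ring_nf

lemma mem_MA_v {M : ℕ} {A : Finset Site} (hA : A ⊆ Bx M) (a b : ℤ) :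
    (2 * a, 2 * b + 1) ∈ MA M A ↔ ¬ ((a, b) ∈ A ↔ (a, b + 1) ∈ A) := by
  rw [← mem_MA hA (Or.inr rfl)]
  simp only [Prod.mk_add_mk]
  ring_nf

lemma MA_cases {M : ℕ} {A : Finset Site} (hA : A ⊆ Bx M) {m : Site} (hm : m ∈ MA M A) :
    ∃ x y, nxt x y ∧ m = x + y ∧ ¬ (x ∈ A ↔ y ∈ A) := by
  obtain ⟨f, hf, rfl⟩ := Finset.mem_image.1 hm
  simp only [bdE, Finset.mem_filter, mem_Dg] at hf
  exact ⟨f.1, f.2, hf.1.2, rfl, hf.2⟩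

def offs : Finset Site :=
  ((Finset.Icc (-2 : ℤ) 2) ×ˢ (Finset.Icc (-2 : ℤ) 2)).filter (fun d => |d.1| + |d.2| ≤ 2)

lemma offs_card : offs.card = 13 := by
  have : offs = (((Finset.Icc (-2 : ℤ) 2) ×ˢ (Finset.Icc (-2 : ℤ) 2)).filter (fun d => |d.1| + |d.2| ≤ 2)) := rfl
  rw [this]; decide +kernel

lemma mem_offs {d : Site} : d ∈ offs ↔ |d.1| + |d.2| ≤ 2 := by
  simp only [offs, Finset.mem_filter, Finset.mem_product, Finset.mem_Icc, and_iff_right_iff_imp]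
  intro h
  have := abs_nonneg d.1
  have := abs_nonneg d.2
  have h1 : |d.1| ≤ 2 := by omega
  have h2 : |d.2| ≤ 2 := by omega
  exact ⟨abs_le.1 h1, abs_le.1 h2⟩

def nb (m : Site) : Finset Site := offs.image (fun d => m + d)

lemma nb_card (m : Site) : (nb m).card ≤ 13 := offs_card ▸ Finset.card_image_le

lemma mem_nb {m m' : Site} : m' ∈ nb m ↔ |m'.1 - m.1| + |m'.2 - m.2| ≤ 2 := by
  rw [nb, Finset.mem_image]
  constructor
  · rintro ⟨d, hd, rfl⟩
    simpa using mem_offs.1 hd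
  · intro h
    exact ⟨m' - m, mem_offs.2 (by simpa using h), by simp⟩

def ConnM (W : Finset Site) : Prop := ∀ ω ⊆ W, ω.Nonempty →
  (∀ x ∈ ω, ∀ y ∈ W, y ∈ nb x → y ∈ ω) → ω = W

/-- percolation counting -/
lemma perc_count (F : Finset (Finset Site)) (v : Site) (hv : ∀ W ∈ F, v ∈ W) (hc : ∀ W ∈ F, ConnM W) :
    ∑ W ∈ F, (1 / 2 : ℝ) ^ (13 * W.card) ≤ 1 := by
  set V : Finset Site := F.biUnion id
  let N : Finset Site → Finset Site := fun W => W.biUnion nb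
  have hWN : ∀ W, W ⊆ N W := fun W x hx => Finset.mem_biUnion.2 ⟨x, hx, mem_nb.2 (by simp)⟩
  have hN : ∀ W, (N W).card ≤ 13 * W.card := fun W =>
    (Finset.card_biUnion_le_card_mul W nb 13 (fun x _ => nb_card x)).trans (by rw [mul_comm])
  have hWV : ∀ W ∈ F, W ⊆ V := fun W hW x hx => Finset.mem_biUnion.2 ⟨W, hW, hx⟩
  let E : Finset Site → Finset (Finset Site) := fun W => V.powerset.filter (fun ω => ω ∩ N W = W)
  have key : ∀ W ∈ F, ∀ W' ∈ F, ∀ ω, ω ∩ N W = W → ω ∩ N W' = W' → W' ⊆ W := by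
    intro W hW W' hW' ω h1 h2
    have h3 : W ∩ W' = W' := by
      apply hc W' hW' _ Finset.inter_subset_right ⟨v, Finset.mem_inter.2 ⟨hv W hW, hv W' hW'⟩⟩
      intro x hx y hy hyx
      rw [Finset.mem_inter] at hx ⊢
      refine ⟨?_, hy⟩
      rw [← h1, Finset.mem_inter]
      rw [← h2, Finset.mem_inter] at hy
      exact ⟨hy.1, Finset.mem_biUnion.2 ⟨x, hx.1, hyx⟩⟩
    rw [← h3]; exact Finset.inter_subset_left
  have hdis : (F : Set (Finset Site)).PairwiseDisjoint E := by
    intro W hW W' hW' hne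
    rw [Function.onFun, Finset.disjoint_left]
    intro ω h1 h2
    simp only [E, Finset.mem_filter] at h1 h2
    exact hne ((key W' hW' W hW ω h2.2 h1.2).antisymm (key W hW W' hW' ω h1.2 h2.2))
  have h1 : ∑ W ∈ F, (E W).card ≤ 2 ^ V.card := by
    rw [← Finset.card_biUnion hdis, ← Finset.card_powerset]
    apply Finset.card_le_card
    intro ω hω
    obtain ⟨W, _, hω⟩ := Finset.mem_biUnion.1 hω
    exact (Finset.mem_filter.1 hω).1
  have h2 : ∀ W ∈ F, 2 ^ (V.card) * (1 / 2 : ℝ) ^ (13 * W.card) ≤ (E W).card := by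
    intro W hW
    have h3 : 2 ^ (V \ N W).card ≤ (E W).card := by
      rw [← Finset.card_powerset]
      apply Finset.card_le_card_of_injOn (fun τ => W ∪ τ)
      · intro τ hτ
        have hτ : τ ⊆ V \ N W := Finset.mem_powerset.1 (Finset.mem_coe.1 hτ)
        simp only [E, Finset.coe_filter, Set.mem_ofPred_eq, Finset.mem_powerset]
        refine ⟨Finset.union_subset (hWV W hW) (hτ.trans Finset.sdiff_subset), ?_⟩
        ext x
        have h4 := @hτ x
        have h5 := @hWN W x
        simp only [Finset.mem_inter, Finset.mem_union, Finset.mem_sdiff] at *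
        tauto
      · intro τ hτ τ' hτ' h
        have hτ : τ ⊆ V \ N W := Finset.mem_powerset.1 (Finset.mem_coe.1 hτ)
        have hτ' : τ' ⊆ V \ N W := Finset.mem_powerset.1 (Finset.mem_coe.1 hτ')
        ext x
        have h4 := @hτ x
        have h4' := @hτ' x
        have h5 := @hWN W x
        have h6 : x ∈ W ∪ τ ↔ x ∈ W ∪ τ' := by
          have h : W ∪ τ = W ∪ τ' := h
          rw [h]
        simp only [Finset.mem_union, Finset.mem_sdiff] at *
        tauto
    have h4 : V.card ≤ (V \ N W).card + 13 * W.card := by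
      have := Finset.le_card_sdiff (N W) V
      have := hN W
      omega
    calc 2 ^ (V.card) * (1 / 2 : ℝ) ^ (13 * W.card)
        ≤ 2 ^ ((V \ N W).card + 13 * W.card) * (1 / 2 : ℝ) ^ (13 * W.card) := by
          gcongr; norm_num
      _ = 2 ^ (V \ N W).card := by
          rw [pow_add, mul_assoc, ← mul_pow]; norm_num
      _ ≤ (E W).card := by exact_mod_cast h3
  have h3 : 2 ^ V.card * ∑ W ∈ F, (1 / 2 : ℝ) ^ (13 * W.card) ≤ 2 ^ V.card * 1 := by
    rw [Finset.mul_sum, mul_one]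
    refine (Finset.sum_le_sum h2).trans ?_
    exact_mod_cast h1
  exact le_of_mul_le_mul_left h3 (by positivity)

lemma MA_bd {M : ℕ} {A : Finset Site} {m : Site} (hm : m ∈ MA M A) : -(2 * (M : ℤ) + 2) ≤ m.1 := by
  obtain ⟨f, hf, rfl⟩ := Finset.mem_image.1 hm
  simp only [bdE, Finset.mem_filter, mem_Dg, mem_Bx] at hf
  simp only [mid, Prod.fst_add]
  push_cast at hf
  omega

lemma MA_par {M : ℕ} {A : Finset Site} (hA : A ⊆ Bx M) {m : Site} (hm : m ∈ MA M A) :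
    (m.1 + m.2) % 2 = 1 := by
  obtain ⟨x, y, h, rfl, -⟩ := MA_cases hA hm
  rcases h with rfl | rfl <;> simp <;> omega

lemma connM_MA {M : ℕ} {A : Finset Site} (hA : A ⊆ Bx M) (hG : Good A) : ConnM (MA M A) := by
  intro ω hω hne hcl
  let χ : Site → ZMod 2 := fun m => if m ∈ ω then 1 else 0
  let F : ℤ → ℤ → ZMod 2 := fun a b => ∑ m ∈ ω, if (m.2 = 2 * b ∧ m.1 < 2 * a) then 1 else 0
  have hF1 : ∀ a b, F (a + 1) b = F a b + χ (2 * a + 1, 2 * b) := by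
    intro a b
    have : χ (2 * a + 1, 2 * b) = ∑ m ∈ ω, if m = (2 * a + 1, 2 * b) then 1 else 0 := by
      simp [χ]
    rw [this]
    simp only [F]
    rw [← Finset.sum_add_distrib]
    refine Finset.sum_congr rfl fun m hm => ?_
    have hp := MA_par hA (hω hm)
    obtain ⟨u, v⟩ := m
    simp only [Prod.mk.injEq] at *
    by_cases hv : v = 2 * b
    · subst hv
      by_cases h1 : u < 2 * a
      · rw [if_pos (by omega), if_pos (by omega), if_neg (by omega)]; simp
      · by_cases h2 : u = 2 * a + 1
        · rw [if_pos (by omega), if_neg (by omega), if_pos (by omega)]; simp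
        · rw [if_neg (by omega), if_neg (by omega), if_neg (by omega)]; simp
    · rw [if_neg (by tauto), if_neg (by tauto), if_neg (by tauto)]; simp
  have hplaq : ∀ a b, χ (2 * a + 1, 2 * b + 2) + χ (2 * a, 2 * b + 1)
      = χ (2 * a + 1, 2 * b) + χ (2 * a + 2, 2 * b + 1) := by
    intro a b
    have e1 := mem_MA_h hA a b
    have e2 := mem_MA_h hA a (b + 1)
    have e3 := mem_MA_v hA a b
    have e4 := mem_MA_v hA (a + 1) b
    rw [mul_add, mul_one] at e2 e4
    set m1 : Site := (2 * a + 1, 2 * b) with hm1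
    set m2 : Site := (2 * a + 1, 2 * b + 2) with hm2
    set m3 : Site := (2 * a, 2 * b + 1) with hm3
    set m4 : Site := (2 * a + 2, 2 * b + 1) with hm4
    have key : ∀ p q : Site, (p = m1 ∨ p = m2 ∨ p = m3 ∨ p = m4) → (q = m1 ∨ q = m2 ∨ q = m3 ∨ q = m4) →
        q ∈ nb p := by
      intro p q hp hq
      rw [mem_nb]
      rcases hp with rfl | rfl | rfl | rfl <;> rcases hq with rfl | rfl | rfl | rfl <;>
        simp [hm1, hm2, hm3, hm4] <;> ring_nf <;> norm_num
    by_cases hex : m1 ∈ ω ∨ m2 ∈ ω ∨ m3 ∈ ω ∨ m4 ∈ ω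
    · have : ∃ p, (p = m1 ∨ p = m2 ∨ p = m3 ∨ p = m4) ∧ p ∈ ω := by
        rcases hex with h | h | h | h
        · exact ⟨m1, by simp, h⟩
        · exact ⟨m2, by simp, h⟩
        · exact ⟨m3, by simp, h⟩
        · exact ⟨m4, by simp, h⟩
      obtain ⟨p, hp, hpω⟩ := this
      have hall : ∀ q, (q = m1 ∨ q = m2 ∨ q = m3 ∨ q = m4) → (q ∈ ω ↔ q ∈ MA M A) := fun q hq =>
        ⟨fun h => hω h, fun h => hcl p hpω q h (key p q hp hq)⟩
      have f1 := (hall m1 (by simp)).trans e1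
      have f2 := (hall m2 (by simp)).trans e2
      have f3 := (hall m3 (by simp)).trans e3
      have f4 := (hall m4 (by simp)).trans e4
      simp only [χ, f1, f2, f3, f4]
      by_cases h1 : (a, b) ∈ A <;> by_cases h2 : (a + 1, b) ∈ A <;> by_cases h3 : (a, b + 1) ∈ A <;>
        by_cases h4 : (a + 1, b + 1) ∈ A <;> simp only [h1, h2, h3, h4] <;> decide
    · push Not at hex
      simp [χ, hex]
  have hF2 : ∀ b a, F a (b + 1) = F a b + χ (2 * a, 2 * b + 1) := by
    intro b
    have hstep : ∀ a, (F (a + 1) (b + 1) = F (a + 1) b + χ (2 * (a + 1), 2 * b + 1)) ↔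
        (F a (b + 1) = F a b + χ (2 * a, 2 * b + 1)) := by
      intro a
      have h := hplaq a b
      rw [hF1, hF1]
      rw [mul_add, mul_add, mul_one]
      generalize χ (2 * a + 1, 2 * b + 2) = u at *
      generalize χ (2 * a + 1, 2 * b) = v at *
      generalize χ (2 * a, 2 * b + 1) = w at *
      generalize χ (2 * a + 2, 2 * b + 1) = z at *
      generalize F a (b + 1) = s
      generalize F a b = t
      revert u v w z s t
      decide
    have hbase : F (-(M + 2)) (b + 1) = F (-(M + 2)) b + χ (2 * (-(M + 2)), 2 * b + 1) := by
      have h1 : ∀ c, F (-(M + 2)) c = 0 := by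
        intro c
        refine Finset.sum_eq_zero fun m hm => if_neg ?_
        have := MA_bd (hω hm)
        omega
      rw [h1, h1]
      simp only [χ]
      rw [if_neg]
      · simp
      · intro h
        have := MA_bd (hω h)
        simp at this; omega
    have hall : ∀ n : ℤ, F (-(M + 2) + n) (b + 1) = F (-(M + 2) + n) b + χ (2 * (-(M + 2) + n), 2 * b + 1) := by
      intro n
      induction n using Int.induction_on with
      | zero => simpa using hbase
      | succ i ih => rw [← add_assoc]; exact (hstep _).2 ih
      | pred i ih =>
        refine (hstep _).1 ?_
        have : -((M : ℤ) + 2) + (-(i : ℤ) - 1) + 1 = -(M + 2) + -i := by ring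
        rw [this]; exact ih
    intro a
    have := hall (a + (M + 2))
    have e : -((M : ℤ) + 2) + (a + (M + 2)) = a := by ring
    rwa [e] at this
  have hF : ∀ x y, nxt x y → F y.1 y.2 = F x.1 x.2 + χ (x + y) := by
    rintro ⟨a, b⟩ y (rfl | rfl)
    · rw [hF1]; congr 2; simp only [Prod.mk_add_mk]; ring_nf
    · rw [hF2]; congr 2; simp only [Prod.mk_add_mk]; ring_nf
  have hχ0 : ∀ x y, nxt x y → (x ∈ A ↔ y ∈ A) → χ (x + y) = 0 := by
    intro x y h hi
    simp only [χ]
    rw [if_neg]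
    intro hm
    exact (mem_MA hA h).1 (hω hm) hi
  have hconst : ∀ x y, nbr x y → (x ∈ A ↔ y ∈ A) → F x.1 x.2 = F y.1 y.2 := by
    rintro x y (h | h) hi
    · rw [hF x y h, hχ0 x y h hi, add_zero]
    · rw [hF y x h, hχ0 y x h hi.symm, add_zero]
  obtain ⟨h0, hc1, hc2⟩ := hG
  have hout : ((M : ℤ) + 1, (0 : ℤ)) ∉ A := fun h => by
    have := mem_Bx.1 (hA h); simp at this
  have hFA : ∀ x ∈ A, F x.1 x.2 = F 0 0 := by
    intro x hx
    refine hc1 (fun x => F x.1 x.2 = F 0 0) ⟨(0, 0), h0, rfl⟩ ?_ x hx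
    intro x hx y hy hxy h
    rw [← h]
    exact (hconst x y hxy (iff_of_true hx hy)).symm
  have hFB : ∀ x ∉ A, F x.1 x.2 = F (M + 1) 0 := by
    intro x hx
    refine hc2 (fun x => F x.1 x.2 = F (M + 1) 0) ⟨(M + 1, 0), hout, rfl⟩ ?_ x hx
    intro x hx y hy hxy h
    rw [← h]
    exact (hconst x y hxy (iff_of_false hx hy)).symm
  have hz : ∀ v u w : ZMod 2, w = v + u → u = v + w := by decide
  have hval : ∀ m ∈ MA M A, χ m = F 0 0 + F (M + 1) 0 := by
    intro m hm
    obtain ⟨x, y, h, rfl, hb⟩ := MA_cases hA hm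
    have h1 := hF x y h
    by_cases hx : x ∈ A
    · have hy : y ∉ A := by tauto
      rw [hFA x hx, hFB y hy] at h1
      exact hz _ _ _ h1
    · have hy : y ∈ A := by tauto
      rw [hFB x hx, hFA y hy] at h1
      exact (hz _ _ _ h1).trans (add_comm _ _)
  obtain ⟨m0, hm0⟩ := hne
  refine hω.antisymm fun m hm => ?_
  have h1 := hval m hm
  rw [← hval m0 (hω hm0)] at h1
  simp only [χ, if_pos hm0] at h1
  by_contra hcon
  rw [if_neg hcon] at h1
  exact absurd h1 (by decide)

lemma MA_inj {M : ℕ} {A A' : Finset Site} (hA : A ⊆ Bx M) (hA' : A' ⊆ Bx M) (h : MA M A = MA M A') : A = A' := by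
  have ho : ∀ A : Finset Site, A ⊆ Bx M → ((M : ℤ) + 1, (0 : ℤ)) ∉ A := fun A hA h => by
    have := mem_Bx.1 (hA h); simp at this
  ext x
  refine conn_univ (fun x => x ∈ A ↔ x ∈ A') ⟨(M + 1, 0), trivial, iff_of_false (ho A hA) (ho A' hA')⟩ ?_ x trivial
  have : ∀ x y, nxt x y → ((x ∈ A ↔ y ∈ A) ↔ (x ∈ A' ↔ y ∈ A')) := by
    intro x y hxy
    have h1 := mem_MA hA hxy
    rw [h, mem_MA hA' hxy] at h1
    tauto
  rintro x - y - (hxy | hxy) hx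
  · have := this x y hxy; tauto
  · have := this y x hxy; tauto

lemma top_v {M : ℕ} {A : Finset Site} (hA : A ⊆ Bx M) (a b : ℤ) (h : (a, b) ∈ A) :
    ∃ n : ℕ, (a, b + n) ∈ A ∧ (a, b + n + 1) ∉ A := by
  by_contra hcon
  push Not at hcon
  have : ∀ n : ℕ, (a, b + n) ∈ A := by
    intro n
    induction n with
    | zero => simpa using h
    | succ n ih => have := hcon n ih; push_cast; rwa [← add_assoc]
  have h2 := mem_Bx.1 (hA (this (2 * M + 1)))
  have h3 := mem_Bx.1 (hA h)
  simp at h2 h3; omega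

lemma top_h {M : ℕ} {A : Finset Site} (hA : A ⊆ Bx M) (a b : ℤ) (h : (a, b) ∈ A) :
    ∃ n : ℕ, (a + n, b) ∈ A ∧ (a + n + 1, b) ∉ A := by
  by_contra hcon
  push Not at hcon
  have : ∀ n : ℕ, (a + n, b) ∈ A := by
    intro n
    induction n with
    | zero => simpa using h
    | succ n ih => have := hcon n ih; push_cast; rwa [← add_assoc]
  have h2 := mem_Bx.1 (hA (this (2 * M + 1)))
  have h3 := mem_Bx.1 (hA h)
  simp at h2 h3; omega

lemma size_h {M : ℕ} {A : Finset Site} (hA : A ⊆ Bx M) (hG : Good A) (a : ℕ) (b : ℤ) (h : ((a : ℤ), b) ∈ A) :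
    a + 1 ≤ (MA M A).card := by
  have h1 : ∀ j : ℕ, j ≤ a → ∃ y : ℤ, (2 * (j : ℤ), y) ∈ MA M A := by
    intro j hj
    have : ∃ y : ℤ, ((j : ℤ), y) ∈ A := by
      rcases Nat.eq_zero_or_pos j with rfl | hj0
      · exact ⟨0, hG.1⟩
      · by_contra hcon
        push Not at hcon
        have := hG.2.1 (fun x => x.1 < j) ⟨(0, 0), hG.1, by simpa using hj0⟩ (by
          rintro ⟨x1, x2⟩ hx ⟨y1, y2⟩ hy hxy hlt
          simp only [nbr, nxt, Prod.mk.injEq] at hxy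
          simp only at hlt ⊢
          have : y1 ≠ j := by rintro rfl; exact hcon _ hy
          omega) _ h
        simp at this; omega
    obtain ⟨y, hy⟩ := this
    obtain ⟨n, hn1, hn2⟩ := top_v hA _ _ hy
    exact ⟨_, (mem_MA_v hA j (y + n)).2 (by tauto)⟩
  choose! f hf using h1
  have h2 : (Finset.range (a + 1)).image (fun j : ℕ => ((2 * (j : ℤ), f j) : Site)) ⊆ MA M A := by
    intro m hm
    obtain ⟨j, hj, rfl⟩ := Finset.mem_image.1 hm
    exact hf j (by simpa [Nat.lt_succ_iff] using hj)
  have h3 := Finset.card_le_card h2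
  rwa [Finset.card_image_of_injective, Finset.card_range] at h3
  intro i j hij
  simp at hij; exact hij.1

lemma size_v {M : ℕ} {A : Finset Site} (hA : A ⊆ Bx M) (hG : Good A) (a : ℕ) (b : ℤ) (h : (b, (a : ℤ)) ∈ A) :
    a + 1 ≤ (MA M A).card := by
  have h1 : ∀ j : ℕ, j ≤ a → ∃ y : ℤ, (y, 2 * (j : ℤ)) ∈ MA M A := by
    intro j hj
    have : ∃ y : ℤ, (y, (j : ℤ)) ∈ A := by
      rcases Nat.eq_zero_or_pos j with rfl | hj0
      · exact ⟨0, hG.1⟩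
      · by_contra hcon
        push Not at hcon
        have := hG.2.1 (fun x => x.2 < j) ⟨(0, 0), hG.1, by simpa using hj0⟩ (by
          rintro ⟨x1, x2⟩ hx ⟨y1, y2⟩ hy hxy hlt
          simp only [nbr, nxt, Prod.mk.injEq] at hxy
          simp only at hlt ⊢
          have : y2 ≠ j := by rintro rfl; exact hcon _ hy
          omega) _ h
        simp at this; omega
    obtain ⟨y, hy⟩ := this
    obtain ⟨n, hn1, hn2⟩ := top_h hA _ _ hy
    exact ⟨_, (mem_MA_h hA (y + n) j).2 (by tauto)⟩
  choose! f hf using h1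
  have h2 : (Finset.range (a + 1)).image (fun j : ℕ => ((f j, 2 * (j : ℤ)) : Site)) ⊆ MA M A := by
    intro m hm
    obtain ⟨j, hj, rfl⟩ := Finset.mem_image.1 hm
    exact hf j (by simpa [Nat.lt_succ_iff] using hj)
  have h3 := Finset.card_le_card h2
  rwa [Finset.card_image_of_injective, Finset.card_range] at h3
  intro i j hij
  simp at hij; exact hij.2

lemma anchor {M : ℕ} {A : Finset Site} (hA : A ⊆ Bx M) (hG : Good A) :
    ∃ k : ℕ, (2 * (k : ℤ) + 1, (0 : ℤ)) ∈ MA M A ∧ k + 1 ≤ (MA M A).card := by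
  obtain ⟨n, h1, h2⟩ := top_h hA 0 0 hG.1
  rw [zero_add] at h1 h2
  refine ⟨n, ?_, size_h hA hG n 0 h1⟩
  have := (mem_MA_h hA n 0).2 (by tauto)
  simpa using this

lemma count_sum (M : ℕ) (G : Finset (Finset Site)) (hG : ∀ A ∈ G, A ⊆ Bx M ∧ Good A) :
    ∑ A ∈ G, (1 / 2 : ℝ) ^ (14 * (MA M A).card) ≤ 1 := by
  have hk : ∀ A : Finset Site, ∃ k : ℕ, A ∈ G → (2 * (k : ℤ) + 1, (0 : ℤ)) ∈ MA M A ∧ k + 1 ≤ (MA M A).card := by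
    intro A
    by_cases h : A ∈ G
    · obtain ⟨k, hk⟩ := anchor (hG A h).1 (hG A h).2
      exact ⟨k, fun _ => hk⟩
    · exact ⟨0, fun h' => absurd h' h⟩
  choose k hk using hk
  set K := G.sup k + 1
  have hmap : ∀ A ∈ G, k A ∈ Finset.range K := fun A hA =>
    Finset.mem_range.2 (Nat.lt_succ_of_le (Finset.le_sup hA))
  calc ∑ A ∈ G, (1 / 2 : ℝ) ^ (14 * (MA M A).card)
      ≤ ∑ A ∈ G, (1 / 2 : ℝ) ^ (k A + 1) * (1 / 2 : ℝ) ^ (13 * (MA M A).card) := by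
        refine Finset.sum_le_sum fun A hA => ?_
        rw [← pow_add]
        have := (hk A hA).2
        exact pow_le_pow_of_le_one (by norm_num) (by norm_num) (by omega)
    _ = ∑ j ∈ Finset.range K, ∑ A ∈ G with k A = j, (1 / 2 : ℝ) ^ (k A + 1) * (1 / 2 : ℝ) ^ (13 * (MA M A).card) :=
        (Finset.sum_fiberwise_of_maps_to hmap _).symm
    _ ≤ ∑ j ∈ Finset.range K, (1 / 2 : ℝ) ^ (j + 1) := by
        refine Finset.sum_le_sum fun j _ => ?_
        have : ∑ A ∈ G with k A = j, (1 / 2 : ℝ) ^ (k A + 1) * (1 / 2 : ℝ) ^ (13 * (MA M A).card)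
            = (1 / 2 : ℝ) ^ (j + 1) * ∑ W ∈ (G.filter (fun A => k A = j)).image (MA M), (1 / 2 : ℝ) ^ (13 * W.card) := by
          rw [Finset.sum_image, Finset.mul_sum]
          · refine Finset.sum_congr rfl fun A hA => ?_
            rw [(Finset.mem_filter.1 hA).2]
          · intro A hA A' hA' h
            have hA := (Finset.mem_filter.1 (Finset.mem_coe.1 hA)).1
            have hA' := (Finset.mem_filter.1 (Finset.mem_coe.1 hA')).1
            exact MA_inj (hG A hA).1 (hG A' hA').1 h
        rw [this]
        refine mul_le_of_le_one_right (by positivity) (perc_count _ (2 * (j : ℤ) + 1, 0) ?_ ?_)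
        · intro W hW
          obtain ⟨A, hA, rfl⟩ := Finset.mem_image.1 hW
          obtain ⟨hA1, rfl⟩ := Finset.mem_filter.1 hA
          exact (hk A hA1).1
        · intro W hW
          obtain ⟨A, hA, rfl⟩ := Finset.mem_image.1 hW
          obtain ⟨hA1, rfl⟩ := Finset.mem_filter.1 hA
          exact connM_MA (hG A hA1).1 (hG A hA1).2
    _ ≤ 1 := by
        have : ∀ K : ℕ, ∑ j ∈ Finset.range K, (1 / 2 : ℝ) ^ (j + 1) = 1 - (1 / 2) ^ K := by
          intro K
          induction K with
          | zero => simp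
          | succ n ih => rw [Finset.sum_range_succ, ih]; ring
        rw [this]
        have : (0 : ℝ) ≤ (1 / 2) ^ K := by positivity
        linarith

def Hn (N : ℕ) : ℝ := ∑ n ∈ Finset.range N, 1 / ((n : ℝ) + 1)

lemma diag_step (n : ℕ) (p q : ℕ → ℝ) :
    ((∑ i ∈ Finset.range (n + 1), p i) / ((n : ℝ) + 1) - (∑ i ∈ Finset.range (n + 2), q i) / ((n : ℝ) + 2)) ^ 2 ≤
      (1 / ((n : ℝ) + 1)) * ∑ i ∈ Finset.range (n + 1), ((p i - q (i + 1)) ^ 2 + (p i - q i) ^ 2) := by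
  set t : ℕ → ℝ := fun i => ((i : ℝ) + 1) * (p i - q (i + 1)) + ((n : ℝ) + 1 - i) * (p i - q i) with ht
  have hid : ∑ i ∈ Finset.range (n + 1), t i =
      ((n : ℝ) + 2) * ∑ i ∈ Finset.range (n + 1), p i - ((n : ℝ) + 1) * ∑ i ∈ Finset.range (n + 2), q i := by
    have h1 : ∑ i ∈ Finset.range (n + 2), (i : ℝ) * q i = ∑ i ∈ Finset.range (n + 1), ((i : ℝ) + 1) * q (i + 1) := by
      rw [Finset.sum_range_succ']; simp
    have h2 : ∑ i ∈ Finset.range (n + 2), ((n : ℝ) + 1 - i) * q i = ∑ i ∈ Finset.range (n + 1), ((n : ℝ) + 1 - i) * q i := by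
      rw [Finset.sum_range_succ]; simp
    have h3 : ((n : ℝ) + 1) * ∑ i ∈ Finset.range (n + 2), q i =
        ∑ i ∈ Finset.range (n + 2), (i : ℝ) * q i + ∑ i ∈ Finset.range (n + 2), ((n : ℝ) + 1 - i) * q i := by
      rw [← Finset.sum_add_distrib, Finset.mul_sum]
      exact Finset.sum_congr rfl fun i _ => by ring
    rw [h3, h1, h2, Finset.mul_sum, ← Finset.sum_add_distrib, ← Finset.sum_sub_distrib]
    exact Finset.sum_congr rfl fun i _ => by simp only [ht]; ring
  have h1 : (∑ i ∈ Finset.range (n + 1), t i) ^ 2 ≤ ((n : ℝ) + 1) * ∑ i ∈ Finset.range (n + 1), t i ^ 2 := by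
    have := sq_sum_le_card_mul_sum_sq (s := Finset.range (n + 1)) (f := t)
    simpa using this
  have h2 : ∑ i ∈ Finset.range (n + 1), t i ^ 2 ≤
      ((n : ℝ) + 2) ^ 2 * ∑ i ∈ Finset.range (n + 1), ((p i - q (i + 1)) ^ 2 + (p i - q i) ^ 2) := by
    rw [Finset.mul_sum]
    refine Finset.sum_le_sum fun i hi => ?_
    have hi : (i : ℝ) ≤ n := by
      have := Finset.mem_range.1 hi
      exact_mod_cast Nat.lt_succ_iff.1 this
    have hi0 : (0 : ℝ) ≤ i := by positivity
    simp only [ht]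
    generalize p i - q (i + 1) = u
    generalize p i - q i = v
    have e : ((n : ℝ) + 2) ^ 2 = ((i : ℝ) + 1) ^ 2 + ((n : ℝ) + 1 - i) ^ 2 + 2 * ((i : ℝ) + 1) * ((n : ℝ) + 1 - i) := by ring
    have hpos : 0 ≤ 2 * ((i : ℝ) + 1) * ((n : ℝ) + 1 - i) * (u ^ 2 + v ^ 2) := by
      have : (0 : ℝ) ≤ (n : ℝ) + 1 - i := by linarith
      positivity
    rw [e]
    nlinarith [sq_nonneg (((i : ℝ) + 1) * v - ((n : ℝ) + 1 - i) * u)]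
  have h3 : ((∑ i ∈ Finset.range (n + 1), p i) / ((n : ℝ) + 1) - (∑ i ∈ Finset.range (n + 2), q i) / ((n : ℝ) + 2))
      = (∑ i ∈ Finset.range (n + 1), t i) / (((n : ℝ) + 1) * ((n : ℝ) + 2)) := by
    rw [hid]; field_simp
  rw [h3, div_pow, div_le_iff₀ (by positivity)]
  refine h1.trans ?_
  calc _ ≤ ((n : ℝ) + 1) * (((n : ℝ) + 2) ^ 2 * ∑ i ∈ Finset.range (n + 1), ((p i - q (i + 1)) ^ 2 + (p i - q i) ^ 2)) := by
        gcongr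
    _ = _ := by field_simp

lemma cap_lower (M : ℕ) (A : Finset Site) (hA : A ⊆ Bx M) (ψ : Site → ℝ) (hψ : ∀ x ∉ A, ψ x = 0)
    (h0 : ψ (0, 0) = 1) (N : ℕ) (hN : ∀ i : ℕ, i ≤ N → ((i : ℤ), (N : ℤ) - i) ∉ A) :
    1 ≤ Hn N * en (Dg (M + 1)) ψ := by
  let s : ℕ → ℝ := fun n => (∑ i ∈ Finset.range (n + 1), ψ ((i : ℤ), (n : ℤ) - i)) / ((n : ℝ) + 1)
  let E : ℕ → ℝ := fun n => ∑ i ∈ Finset.range (n + 1),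
    ((ψ ((i : ℤ), (n : ℤ) - i) - ψ ((i : ℤ) + 1, (n : ℤ) - i)) ^ 2 +
      (ψ ((i : ℤ), (n : ℤ) - i) - ψ ((i : ℤ), (n : ℤ) - i + 1)) ^ 2)
  have hs0 : s 0 = 1 := by simp [s, h0]
  have hsN : s N = 0 := by
    simp only [s]
    rw [Finset.sum_eq_zero, zero_div]
    intro i hi
    exact hψ _ (hN i (by have := Finset.mem_range.1 hi; omega))
  have hstep : ∀ n, (s n - s (n + 1)) ^ 2 ≤ (1 / ((n : ℝ) + 1)) * E n := by
    intro n
    have := diag_step n (fun i => ψ ((i : ℤ), (n : ℤ) - i)) (fun i => ψ ((i : ℤ), ((n + 1 : ℕ) : ℤ) - i))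
    have e1 : s n - s (n + 1) = ((∑ i ∈ Finset.range (n + 1), ψ ((i : ℤ), (n : ℤ) - i)) / ((n : ℝ) + 1) -
        (∑ i ∈ Finset.range (n + 2), ψ ((i : ℤ), ((n + 1 : ℕ) : ℤ) - i)) / ((n : ℝ) + 2)) := by
      simp only [s]; push_cast; ring_nf
    rw [e1]
    refine this.trans (le_of_eq ?_)
    congr 1
    refine Finset.sum_congr rfl fun i _ => ?_
    have a1 : ((n + 1 : ℕ) : ℤ) - ((i + 1 : ℕ) : ℤ) = (n : ℤ) - i := by push_cast; ring
    have a2 : ((n + 1 : ℕ) : ℤ) - (i : ℤ) = (n : ℤ) - i + 1 := by push_cast; ring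
    simp only [a1, a2]
    push_cast
    rfl
  have hsum : ∑ n ∈ Finset.range N, (s n - s (n + 1)) = 1 := by
    rw [Finset.sum_range_sub', hs0, hsN, sub_zero]
  have hE : ∀ n, 0 ≤ E n := fun n => Finset.sum_nonneg fun _ _ => by positivity
  have hCS : (∑ n ∈ Finset.range N, (s n - s (n + 1))) ^ 2 ≤ Hn N * ∑ n ∈ Finset.range N, E n :=
    Finset.sum_sq_le_sum_mul_sum_of_sq_le_mul _ (fun _ _ => by positivity) (fun n _ => hE n) (fun n _ => hstep n)
  rw [hsum, one_pow] at hCS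
  refine hCS.trans ?_
  have hH : 0 ≤ Hn N := Finset.sum_nonneg fun _ _ => by positivity
  refine mul_le_mul_of_nonneg_left ?_ hH
  let T : Finset ((Σ _ : ℕ, ℕ) × Bool) := ((Finset.range N).sigma (fun n => Finset.range (n + 1))) ×ˢ Finset.univ
  let e : ((Σ _ : ℕ, ℕ) × Bool) → Site × Site := fun t =>
    (((t.1.2 : ℤ), (t.1.1 : ℤ) - t.1.2),
      if t.2 then ((t.1.2 : ℤ) + 1, (t.1.1 : ℤ) - t.1.2) else ((t.1.2 : ℤ), (t.1.1 : ℤ) - t.1.2 + 1))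
  have he : Function.Injective e := by
    rintro ⟨⟨n, i⟩, b⟩ ⟨⟨n', i'⟩, b'⟩ h
    simp only [e, Prod.mk.injEq] at h
    obtain ⟨⟨h1, h2⟩, h3⟩ := h
    have h1 : i = i' := by omega
    subst h1
    have h2 : n = n' := by omega
    subst h2
    cases b <;> cases b' <;> simp at h3 ⊢
  have e1 : ∑ n ∈ Finset.range N, E n = ∑ t ∈ T, (ψ (e t).1 - ψ (e t).2) ^ 2 := by
    rw [Finset.sum_product, Finset.sum_sigma]
    refine Finset.sum_congr rfl fun n _ => Finset.sum_congr rfl fun i _ => ?_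
    rw [Fintype.sum_bool]
    simp [e]
  rw [e1, ← Finset.sum_image (f := fun p : Site × Site => (ψ p.1 - ψ p.2) ^ 2) (fun a _ b _ h => he h)]
  rw [en]
  rw [← Finset.sum_filter_add_sum_filter_not _ (fun p => p ∈ Dg (M + 1))]
  rw [add_eq_left.2]
  · refine Finset.sum_le_sum_of_subset_of_nonneg (fun p hp => (Finset.mem_filter.1 hp).2) fun _ _ _ => sq_nonneg _
  · refine Finset.sum_eq_zero fun p hp => ?_
    obtain ⟨hp1, hp2⟩ := Finset.mem_filter.1 hp
    obtain ⟨⟨⟨n, i⟩, b⟩, -, rfl⟩ := Finset.mem_image.1 hp1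
    have hnx : nxt (e (⟨n, i⟩, b)).1 (e (⟨n, i⟩, b)).2 := by
      cases b
      · right; simp [e]
      · left; simp [e]
    generalize e (⟨n, i⟩, b) = f at *
    obtain ⟨⟨x1, x2⟩, ⟨y1, y2⟩⟩ := f
    simp only [nxt, mem_Dg, mem_Bx, Prod.mk.injEq] at *
    have g1 : (x1, x2) ∉ A := fun h => hp2 (by
      have := mem_Bx.1 (hA h); simp only at this; push_cast; omega)
    have g2 : (y1, y2) ∉ A := fun h => hp2 (by
      have := mem_Bx.1 (hA h); simp only at this; push_cast; omega)
    rw [hψ _ g1, hψ _ g2]; simp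

lemma Hn_pos {N : ℕ} (h : 0 < N) : 0 < Hn N :=
  Finset.sum_pos (fun _ _ => by positivity) ⟨0, Finset.mem_range.2 h⟩

lemma cap_good (M : ℕ) (A : Finset Site) (hA : A ⊆ Bx M) (hG : Good A) (g : Site → ℝ)
    (hg : Supp (A.erase (0, 0)) g) : 1 / Hn (2 * (MA M A).card) ≤ en (Dg (M + 1)) (dl + g) := by
  have hn : 0 < (MA M A).card := by
    obtain ⟨k, _, h⟩ := anchor hA hG; omega
  rw [div_le_iff₀ (Hn_pos (by omega)), mul_comm]
  apply cap_lower M A hA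
  · intro x hx
    have h1 : x ≠ (0, 0) := by rintro rfl; exact hx hG.1
    simp [dl, h1, hg x (fun h => hx (Finset.mem_of_mem_erase h))]
  · simp [dl, hg (0, 0) (by simp)]
  · intro i hi hmem
    have h1 := size_h hA hG i _ hmem
    have e : ((2 * (MA M A).card : ℕ) : ℤ) - i = ((2 * (MA M A).card - i : ℕ) : ℤ) := by omega
    rw [e] at hmem
    have h2 := size_v hA hG _ _ hmem
    omega

lemma cluster_bound (M : ℕ) (β : ℝ) (hβ : 0 < β) (Λ : Finset Site) (hΛM : Λ ⊆ Bx M) (h00 : (0, 0) ∈ Λ)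
    (p : Site) (hp : p ∉ Λ)
    (hΛ : ∀ x ∉ Λ, x ∈ Comp ((Λ : Set Site)ᶜ) p) (h : ℤ) (hh : 1 ≤ h) :
    Th (Dg (M + 1)) β (Λ.erase (0, 0)) ((h : ℝ) • dl) ≤
      ∑ A ∈ Λ.powerset.filter Good, ENNReal.ofReal (Real.exp (-β * (MA M A).card)) *
        (Th (Dg (M + 1)) β (A.erase (0, 0)) (((h - 1 : ℤ) : ℝ) • dl) * Th (Dg (M + 1)) β (Λ \ A) 0) := by
  set D := Dg (M + 1)
  set G := Λ.powerset.filter Good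
  let I := Σ A : {A // A ∈ G}, LatS (A.1.erase (0, 0)) × LatS (Λ \ A.1)
  let term : I → ENNReal := fun i => ENNReal.ofReal (Real.exp (-β * (MA M i.1.1).card)) *
    (wt D β (re i.2.1 + (((h - 1 : ℤ) : ℝ) • dl)) * wt D β (re i.2.2 + 0))
  have hR : ∑ A ∈ G, ENNReal.ofReal (Real.exp (-β * (MA M A).card)) *
        (Th D β (A.erase (0, 0)) (((h - 1 : ℤ) : ℝ) • dl) * Th D β (Λ \ A) 0) = ∑' i : I, term i := by
    rw [ENNReal.tsum_sigma', tsum_fintype, ← Finset.sum_coe_sort G]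
    refine Finset.sum_congr rfl fun A _ => ?_
    simp only [term]
    rw [ENNReal.tsum_mul_left, ENNReal.tsum_prod']
    congr 1
    simp only [Th, ENNReal.tsum_mul_left, ENNReal.tsum_mul_right]
  rw [hR, Th_eq_full _ _ _ h00]
  let C : Set (Site → ℤ) := {η | (∀ x ∉ Λ, η x = 0) ∧ η (0, 0) = h}
  let Ψ : I → Site → ℤ := fun i x => (if x ∈ i.1.1 then 1 else 0) + (i.2.1.1 x +
    (if x = (0, 0) then h - 1 else 0)) + i.2.2.1 x
  have key : ∀ η : C, ∃ i : I, Ψ i = η.1 ∧ ENNReal.ofReal (ind D β Λ 0 h η.1) ≤ term i := by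
    rintro ⟨η, hη, hη0⟩
    obtain ⟨A, hAΛ, hG, hbd⟩ := exists_cluster Λ p hp hΛ η hη (by omega)
    have hAG : A ∈ G := Finset.mem_filter.2 ⟨Finset.mem_powerset.2 hAΛ, hG⟩
    let n : LatS (A.erase (0, 0)) := ⟨fun x => if x ∈ A.erase (0, 0) then η x - 1 else 0, fun x hx => if_neg hx⟩
    let m : LatS (Λ \ A) := ⟨fun x => if x ∈ Λ \ A then η x else 0, fun x hx => if_neg hx⟩
    have hn : ∀ x, n.1 x + (if x = (0, 0) then h - 1 else 0) = if x ∈ A then η x - 1 else 0 := by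
      intro x
      simp only [n, Finset.mem_erase]
      by_cases hx : x = (0, 0)
      · subst hx; simp [hG.1, hη0]
      · simp [hx]
    have hm : ∀ x, m.1 x = if x ∈ A then 0 else η x := by
      intro x
      simp only [m, Finset.mem_sdiff]
      by_cases hx : x ∈ A
      · simp [hx]
      · by_cases hx' : x ∈ Λ
        · simp [hx, hx']
        · simp [hx', hη x hx']
    refine ⟨⟨⟨A, hAG⟩, (n, m)⟩, ?_, ?_⟩
    · ext x
      simp only [Ψ]
      rw [hn, hm]
      by_cases hx : x ∈ A <;> simp [hx]
    · have hind : ind D β Λ 0 h η = Real.exp (-β * en D (re η)) := if_pos ⟨hη, hη0⟩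
      rw [hind]
      simp only [term, wt]
      rw [← ENNReal.ofReal_mul (Real.exp_pos _).le, ← ENNReal.ofReal_mul (Real.exp_pos _).le]
      refine ENNReal.ofReal_le_ofReal ?_
      rw [← Real.exp_add, ← Real.exp_add]
      refine Real.exp_le_exp.2 ?_
      have hen : ((MA M A).card : ℝ) + (en D (re n + (((h - 1 : ℤ) : ℝ) • dl)) + en D (re m + 0)) ≤ en D (re η) := by
        have e1 : re n + (((h - 1 : ℤ) : ℝ) • dl) = fun x => ((if x ∈ A then η x - 1 else 0 : ℤ) : ℝ) := by
          ext x
          rw [← hn x]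
          simp [re, dl]
        have e2 : re m + 0 = fun x => ((if x ∈ A then 0 else η x : ℤ) : ℝ) := by
          ext x
          rw [← hm x]; simp [re]
        have e3 : ((MA M A).card : ℝ) = ∑ e ∈ D, if ¬ (e.1 ∈ A ↔ e.2 ∈ A) then 1 else 0 := by
          rw [card_MA, bdE, Finset.sum_boole]
        rw [e1, e2, e3]
        simp only [en, ← Finset.sum_add_distrib]
        refine Finset.sum_le_sum fun e he => ?_
        have hnx : nbr e.1 e.2 := Or.inl (mem_Dg.1 he).2
        simp only [re]
        by_cases h1 : e.1 ∈ A <;> by_cases h2 : e.2 ∈ A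
        · simp [h1, h2]
        · have := hbd _ h1 _ h2 hnx
          have t1 : (1 : ℝ) ≤ η e.1 := by exact_mod_cast this.1
          have t2 : (η e.2 : ℝ) ≤ 0 := by exact_mod_cast this.2
          simp [h1, h2]
          nlinarith [mul_nonneg (sub_nonneg.2 t1) (neg_nonneg.2 t2)]
        · have := hbd _ h2 _ h1 (nbr_symm hnx)
          have t1 : (1 : ℝ) ≤ η e.2 := by exact_mod_cast this.1
          have t2 : (η e.1 : ℝ) ≤ 0 := by exact_mod_cast this.2
          simp [h1, h2]
          nlinarith [mul_nonneg (sub_nonneg.2 t1) (neg_nonneg.2 t2)]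
        · simp [h1, h2]
      have := mul_le_mul_of_nonneg_left hen hβ.le
      linarith
  choose F hF1 hF2 using key
  have hFi : Function.Injective F := fun a b hab => Subtype.ext (by rw [← hF1 a, ← hF1 b, hab])
  calc ∑' η : Site → ℤ, ENNReal.ofReal (ind D β Λ 0 h η)
      = ∑' η : C, ENNReal.ofReal (ind D β Λ 0 h η.1) := by
        rw [tsum_subtype_eq_of_support_subset (f := fun η => ENNReal.ofReal (ind D β Λ 0 h η))]
        intro η hη
        by_contra hc
        have hc1 : ¬ ((∀ x ∉ Λ, η x = 0) ∧ η (0, 0) = h) := hc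
        exact hη (by simp only [ind]; rw [if_neg hc1]; simp)
    _ ≤ ∑' η : C, term (F η) := ENNReal.tsum_le_tsum hF2
    _ ≤ ∑' i : I, term i := ENNReal.tsum_comp_le_tsum_of_injective hFi _

lemma upper_bound (M : ℕ) (β : ℝ) (hβ : 28 ≤ β) (Λ : Finset Site) (hΛM : Λ ⊆ Bx M) (h00 : (0, 0) ∈ Λ)
    (p : Site) (hp : p ∉ Λ)
    (hΛ : ∀ x ∉ Λ, x ∈ Comp ((Λ : Set Site)ᶜ) p) (h : ℤ) (hh : 1 ≤ h) (Q : ℝ)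
    (hQ : ∀ n : ℕ, 1 ≤ n → Q ≤ (n : ℝ) / 2 + ((h : ℝ) - 1) ^ 2 / Hn (2 * n)) :
    Th (Dg (M + 1)) β (Λ.erase (0, 0)) ((h : ℝ) • dl) ≤
      ENNReal.ofReal (Real.exp (-β * Q)) * Th (Dg (M + 1)) β (Λ.erase (0, 0)) 0 := by
  have hβ0 : 0 < β := by linarith
  refine (cluster_bound M β hβ0 Λ hΛM h00 p hp hΛ h hh).trans ?_
  have hG : ∀ A ∈ Λ.powerset.filter Good, A ⊆ Bx M ∧ Good A := fun A hA =>
    ⟨(Finset.mem_powerset.1 (Finset.mem_filter.1 hA).1).trans hΛM, (Finset.mem_filter.1 hA).2⟩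
  have hterm : ∀ A ∈ Λ.powerset.filter Good, ENNReal.ofReal (Real.exp (-β * (MA M A).card)) *
        (Th (Dg (M + 1)) β (A.erase (0, 0)) (((h - 1 : ℤ) : ℝ) • dl) * Th (Dg (M + 1)) β (Λ \ A) 0) ≤
      ENNReal.ofReal ((1 / 2 : ℝ) ^ (14 * (MA M A).card)) *
        (ENNReal.ofReal (Real.exp (-β * Q)) * Th (Dg (M + 1)) β (Λ.erase (0, 0)) 0) := by
    intro A hA
    obtain ⟨hAM, hAG⟩ := hG A hA
    have hAΛ := Finset.mem_powerset.1 (Finset.mem_filter.1 hA).1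
    set n := (MA M A).card with hn
    have hn1 : 1 ≤ n := by
      obtain ⟨k, _, hk⟩ := anchor hAM hAG; omega
    have h1 := Th_cap (Dg (M + 1)) β hβ0 (A.erase (0, 0))
      (coer_Dg M _ ((Finset.erase_subset _ _).trans hAM)) dl ((h - 1 : ℤ) : ℝ) (1 / Hn (2 * n))
      (cap_good M A hAM hAG)
    have hdis : Disjoint (A.erase (0, 0)) (Λ \ A) :=
      Finset.disjoint_of_subset_left (Finset.erase_subset _ _) Finset.disjoint_sdiff
    have hun : A.erase (0, 0) ∪ (Λ \ A) = Λ.erase (0, 0) := by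
      ext x
      simp only [Finset.mem_union, Finset.mem_erase, Finset.mem_sdiff]
      have := @hAΛ x
      by_cases hx : x = (0, 0)
      · subst hx; have := hAG.1; tauto
      · tauto
    have h2 := Th_union (Dg (M + 1)) β (A.erase (0, 0)) (Λ \ A) hdis
    rw [hun] at h2
    calc _ ≤ ENNReal.ofReal (Real.exp (-β * n)) *
        (ENNReal.ofReal (Real.exp (-β * (((h - 1 : ℤ) : ℝ) ^ 2 * (1 / Hn (2 * n))))) * Th (Dg (M + 1)) β (A.erase (0, 0)) 0 *
          Th (Dg (M + 1)) β (Λ \ A) 0) := by gcongr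
      _ = ENNReal.ofReal (Real.exp (-β * n)) *
        ENNReal.ofReal (Real.exp (-β * (((h - 1 : ℤ) : ℝ) ^ 2 * (1 / Hn (2 * n))))) * (Th (Dg (M + 1)) β (A.erase (0, 0)) 0 *
          Th (Dg (M + 1)) β (Λ \ A) 0) := by ring
      _ ≤ (ENNReal.ofReal ((1 / 2 : ℝ) ^ (14 * n)) * ENNReal.ofReal (Real.exp (-β * Q))) *
          Th (Dg (M + 1)) β (Λ.erase (0, 0)) 0 := by
          refine mul_le_mul' ?_ h2
          rw [← ENNReal.ofReal_mul (Real.exp_pos _).le, ← ENNReal.ofReal_mul (by positivity)]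
          refine ENNReal.ofReal_le_ofReal ?_
          have hhalf : Real.exp (-1) ≤ 1 / 2 := by
            rw [Real.exp_neg, one_div]
            have := Real.add_one_le_exp (1 : ℝ)
            exact inv_anti₀ (by norm_num) (by linarith)
          have g1 : Real.exp (-β * n) * Real.exp (-β * (((h - 1 : ℤ) : ℝ) ^ 2 * (1 / Hn (2 * n)))) ≤
              Real.exp (-1) ^ (14 * n) * Real.exp (-β * Q) := by
            rw [← Real.exp_nat_mul, ← Real.exp_add, ← Real.exp_add]
            refine Real.exp_le_exp.2 ?_
            have q := mul_le_mul_of_nonneg_left (hQ n hn1) hβ0.le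
            have n0 : (0 : ℝ) ≤ n := by positivity
            push_cast
            have q2 : 28 * (n : ℝ) ≤ β * n := by gcongr
            rw [show ((h : ℝ) - 1) ^ 2 / Hn (2 * n) = ((h : ℝ) - 1) ^ 2 * (1 / Hn (2 * n)) by ring] at q
            nlinarith
          refine g1.trans ?_
          gcongr
      _ = _ := by ring
  refine (Finset.sum_le_sum hterm).trans ?_
  rw [← Finset.sum_mul]
  refine mul_le_of_le_one_left' ?_
  rw [← ENNReal.ofReal_sum_of_nonneg (fun _ _ => by positivity)]
  rw [← ENNReal.ofReal_one]
  exact ENNReal.ofReal_le_ofReal (count_sum M _ hG)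

lemma mem_ball_iff (L : ℕ) (x : Site) : x ∈ ball (L : ℝ) ↔ x.1 ^ 2 + x.2 ^ 2 ≤ (L : ℤ) ^ 2 := by
  simp only [ball, Finset.mem_filter, Finset.mem_product, Finset.mem_Icc, Int.ceil_natCast]
  constructor
  · rintro ⟨-, h⟩; exact_mod_cast h
  · intro h
    have hL : (0 : ℤ) ≤ L := by positivity
    have h1 : |x.1| ≤ L := abs_le_of_sq_le_sq (by nlinarith [sq_nonneg x.2]) hL
    have h2 : |x.2| ≤ L := abs_le_of_sq_le_sq (by nlinarith [sq_nonneg x.1]) hL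
    exact ⟨⟨abs_le.1 h1, abs_le.1 h2⟩, by exact_mod_cast h⟩

lemma ball_sub_Bx (L : ℕ) : ball (L : ℝ) ⊆ Bx L := by
  intro x hx
  rw [mem_ball_iff] at hx
  have hL : (0 : ℤ) ≤ L := by positivity
  have h1 : |x.1| ≤ L := abs_le_of_sq_le_sq (by nlinarith [sq_nonneg x.2]) hL
  have h2 : |x.2| ≤ L := abs_le_of_sq_le_sq (by nlinarith [sq_nonneg x.1]) hL
  exact mem_Bx.2 ⟨abs_le.1 h1, abs_le.1 h2⟩

lemma hline (T : Set Site) (a b : ℤ) (n : ℕ) (h : ∀ k : ℕ, k ≤ n → (a + k, b) ∈ T) :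
    Relation.ReflTransGen (stepR T) (a, b) (a + n, b) := by
  induction n with
  | zero => simpa using Relation.ReflTransGen.refl
  | succ n ih =>
    refine (ih fun k hk => h k (by omega)).tail ⟨Or.inl (Or.inl ?_), h n (by omega), h (n + 1) le_rfl⟩
    simp [add_assoc]

lemma vline (T : Set Site) (a b : ℤ) (n : ℕ) (h : ∀ k : ℕ, k ≤ n → (a, b + k) ∈ T) :
    Relation.ReflTransGen (stepR T) (a, b) (a, b + n) := by
  induction n with
  | zero => simpa using Relation.ReflTransGen.refl
  | succ n ih =>
    refine (ih fun k hk => h k (by omega)).tail ⟨Or.inl (Or.inr ?_), h n (by omega), h (n + 1) le_rfl⟩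
    simp [add_assoc]

lemma hline2 (T : Set Site) (a c b : ℤ) (hac : a ≤ c) (h : ∀ k, a ≤ k → k ≤ c → (k, b) ∈ T) :
    Relation.ReflTransGen (stepR T) (a, b) (c, b) := by
  have := hline T a b (c - a).toNat (fun k hk => h _ (by omega) (by omega))
  have e : a + ((c - a).toNat : ℤ) = c := by omega
  rwa [e] at this

lemma vline2 (T : Set Site) (a b c : ℤ) (hac : b ≤ c) (h : ∀ k, b ≤ k → k ≤ c → (a, k) ∈ T) :
    Relation.ReflTransGen (stepR T) (a, b) (a, c) := by
  have := vline T a b (c - b).toNat (fun k hk => h _ (by omega) (by omega))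
  have e : b + ((c - b).toNat : ℤ) = c := by omega
  rwa [e] at this

lemma vline3 (T : Set Site) (a b c : ℤ) (h : ∀ k, (a, k) ∈ T) :
    Relation.ReflTransGen (stepR T) (a, b) (a, c) := by
  rcases le_total b c with hbc | hbc
  · exact vline2 T a b c hbc fun k _ _ => h k
  · exact rtg_symm (vline2 T a c b hbc fun k _ _ => h k)

lemma ball_out (L : ℕ) (x : Site) (hx : x ∉ ball (L : ℝ)) :
    x ∈ Comp ((ball (L : ℝ) : Set Site)ᶜ) ((L : ℤ) + 1, 0) := by
  set T : Set Site := (ball (L : ℝ) : Set Site)ᶜ with hT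
  have hmem : ∀ a b : ℤ, (a, b) ∈ T ↔ (L : ℤ) ^ 2 < a ^ 2 + b ^ 2 := by
    intro a b
    rw [hT, Set.mem_compl_iff, Finset.mem_coe, mem_ball_iff, not_le]
  have hL : (0 : ℤ) ≤ L := by positivity
  obtain ⟨a, b⟩ := x
  have hx' : (L : ℤ) ^ 2 < a ^ 2 + b ^ 2 := (hmem a b).1 hx
  have hbig1 : ∀ a b : ℤ, (L : ℤ) + 1 ≤ a → (a, b) ∈ T := fun a b h => (hmem a b).2 (by nlinarith [sq_nonneg b])
  have hbig2 : ∀ a b : ℤ, (L : ℤ) + 1 ≤ b → (a, b) ∈ T := fun a b h => (hmem a b).2 (by nlinarith [sq_nonneg a])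
  have hbig3 : ∀ a b : ℤ, (L : ℤ) + 1 ≤ -a → (a, b) ∈ T := fun a b h => (hmem a b).2 (by nlinarith [sq_nonneg b])
  refine rtg_symm ?_
  rcases le_total 0 a with ha | ha
  · have p1 := hline2 T a (a + L + 1) b (by omega) (fun k h1 _ => (hmem k b).2 (by nlinarith))
    have p2 := vline3 T (a + L + 1) b 0 (fun k => hbig1 _ _ (by omega))
    have p3 := rtg_symm (hline2 T (L + 1) (a + L + 1) 0 (by omega) (fun k h1 _ => hbig1 _ _ h1))
    exact (p1.trans p2).trans p3
  · have p1 := rtg_symm (hline2 T (a - L - 1) a b (by omega) (fun k _ h1 => (hmem k b).2 (by nlinarith)))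
    have p2 := vline3 T (a - L - 1) b (L + 1) (fun k => hbig3 _ _ (by omega))
    have p3 := hline2 T (a - L - 1) (L + 1) (L + 1) (by omega) (fun k _ _ => hbig2 _ _ le_rfl)
    have p4 := vline3 T (L + 1) (L + 1) 0 (fun k => hbig1 _ _ le_rfl)
    exact ((p1.trans p2).trans p3).trans p4

def nm (x : Site) : ℕ := max x.1.natAbs x.2.natAbs

def lvl (n : ℕ) : Finset (Site × Site) :=
  ((Finset.Icc (-(n : ℤ)) n).image (fun b => (((n : ℤ), b), ((n : ℤ) + 1, b))) ∪
  (Finset.Icc (-(n : ℤ)) n).image (fun b => ((-(n : ℤ) - 1, b), (-(n : ℤ), b)))) ∪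
  ((Finset.Icc (-(n : ℤ)) n).image (fun b => ((b, (n : ℤ)), (b, (n : ℤ) + 1))) ∪
  (Finset.Icc (-(n : ℤ)) n).image (fun b => ((b, -(n : ℤ) - 1), (b, -(n : ℤ)))))

lemma lvl_card (n : ℕ) : (lvl n).card ≤ 4 * (2 * n + 1) := by
  have hc : (Finset.Icc (-(n : ℤ)) n).card = 2 * n + 1 := by rw [Int.card_Icc]; omega
  have hi : ∀ f : ℤ → Site × Site, ((Finset.Icc (-(n : ℤ)) n).image f).card ≤ 2 * n + 1 := fun f =>
    Finset.card_image_le.trans hc.le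
  unfold lvl
  refine (Finset.card_union_le _ _).trans ?_
  have h1 := Finset.card_union_le ((Finset.Icc (-(n : ℤ)) n).image (fun b => (((n : ℤ), b), ((n : ℤ) + 1, b))))
    ((Finset.Icc (-(n : ℤ)) n).image (fun b => ((-(n : ℤ) - 1, b), (-(n : ℤ), b))))
  have h2 := Finset.card_union_le ((Finset.Icc (-(n : ℤ)) n).image (fun b => ((b, (n : ℤ)), (b, (n : ℤ) + 1))))
    ((Finset.Icc (-(n : ℤ)) n).image (fun b => ((b, -(n : ℤ) - 1), (b, -(n : ℤ)))))
  have := hi (fun b => (((n : ℤ), b), ((n : ℤ) + 1, b)))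
  have := hi (fun b => ((-(n : ℤ) - 1, b), (-(n : ℤ), b)))
  have := hi (fun b => ((b, (n : ℤ)), (b, (n : ℤ) + 1)))
  have := hi (fun b => ((b, -(n : ℤ) - 1), (b, -(n : ℤ))))
  omega

lemma lvl_mem {x y : Site} (h : nxt x y) (hne : nm x ≠ nm y) : (x, y) ∈ lvl (min (nm x) (nm y)) ∧
    ((nm x = min (nm x) (nm y) ∧ nm y = min (nm x) (nm y) + 1) ∨
     (nm y = min (nm x) (nm y) ∧ nm x = min (nm x) (nm y) + 1)) := by
  obtain ⟨a, b⟩ := x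
  obtain ⟨c, d⟩ := y
  simp only [nxt, Prod.mk.injEq] at h
  generalize hn : min (nm (a, b)) (nm (c, d)) = n
  simp only [nm] at *
  constructor
  · simp only [lvl, Finset.mem_union, Finset.mem_image, Finset.mem_Icc, Prod.mk.injEq]
    rcases h with ⟨q1, q2⟩ | ⟨q1, q2⟩
    · left
      by_cases ha : 0 ≤ a
      · left; exact ⟨b, by omega, by omega, by omega⟩
      · right; exact ⟨b, by omega, by omega, by omega⟩
    · right
      by_cases ha : 0 ≤ b
      · left; exact ⟨a, by omega, by omega, by omega⟩
      · right; exact ⟨a, by omega, by omega, by omega⟩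
  · omega

lemma radial_en (M R : ℕ) (g : ℕ → ℤ) (hg : ∀ n, R ≤ n → g n = 0) (δ : ℕ → ℝ)
    (hδ : ∀ n < R, (((g n : ℤ) : ℝ) - g (n + 1)) ^ 2 ≤ δ n) :
    en (Dg M) (re fun x => g (nm x)) ≤ ∑ n ∈ Finset.range R, (4 * (2 * n + 1) : ℝ) * δ n := by
  set f : Site × Site → ℝ := fun e => (re (fun x => g (nm x)) e.1 - re (fun x => g (nm x)) e.2) ^ 2 with hf
  have hδ0 : ∀ n < R, 0 ≤ δ n := fun n hn => (sq_nonneg _).trans (hδ n hn)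
  set D' := (Dg M).filter (fun e => f e ≠ 0)
  have h1 : en (Dg M) (re fun x => g (nm x)) = ∑ e ∈ D', f e := by
    rw [en, Finset.sum_filter_ne_zero]
  have hD : ∀ e ∈ D', nxt e.1 e.2 ∧ nm e.1 ≠ nm e.2 ∧ min (nm e.1) (nm e.2) < R ∧ f e ≠ 0 := by
    intro e he
    obtain ⟨he1, he2⟩ := Finset.mem_filter.1 he
    refine ⟨(mem_Dg.1 he1).2, ?_, ?_, he2⟩
    · intro h; exact he2 (by simp [hf, re, h])
    · by_contra hc
      push Not at hc
      exact he2 (by simp [hf, re, hg _ (hc.trans (min_le_left _ _)), hg _ (hc.trans (min_le_right _ _))])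
  rw [h1, ← Finset.sum_fiberwise_of_maps_to (s := D') (t := Finset.range R) (g := fun e => min (nm e.1) (nm e.2))
    (fun e he => Finset.mem_range.2 (hD e he).2.2.1)]
  refine Finset.sum_le_sum fun n hn => ?_
  have hn := Finset.mem_range.1 hn
  have hsub : (D'.filter (fun e => min (nm e.1) (nm e.2) = n)) ⊆ lvl n := by
    intro e he
    obtain ⟨he1, rfl⟩ := Finset.mem_filter.1 he
    exact (lvl_mem (hD e he1).1 (hD e he1).2.1).1
  have hle : ∀ e ∈ D'.filter (fun e => min (nm e.1) (nm e.2) = n), f e ≤ δ n := by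
    intro e he
    obtain ⟨he1, hen⟩ := Finset.mem_filter.1 he
    have := (lvl_mem (hD e he1).1 (hD e he1).2.1).2
    rw [hen] at this
    refine le_trans (le_of_eq ?_) (hδ n hn)
    simp only [hf, re]
    rcases this with ⟨a1, a2⟩ | ⟨a1, a2⟩
    · rw [a1, a2]
    · rw [a1, a2]; ring
  calc _ ≤ ((D'.filter (fun e => min (nm e.1) (nm e.2) = n)).card : ℝ) * δ n := by
        simpa using Finset.sum_le_card_nsmul _ _ _ hle
    _ ≤ (4 * (2 * n + 1) : ℝ) * δ n := by
        refine mul_le_mul_of_nonneg_right ?_ (hδ0 n hn)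
        exact_mod_cast (Finset.card_le_card hsub).trans (lvl_card n)

lemma Hn_succ (n : ℕ) : Hn (n + 1) = Hn n + 1 / ((n : ℝ) + 1) := by
  rw [Hn, Finset.sum_range_succ]; rfl

lemma Hn_eq (n : ℕ) : Hn n = (harmonic n : ℝ) := by
  simp [Hn, harmonic]

lemma phi_exists (M h R : ℕ) (hR : 1 ≤ R) : ∃ φ : Site → ℤ, φ (0, 0) = 2 * h ∧ (∀ x, R ≤ nm x → φ x = 0) ∧
    en (Dg M) (re φ) ≤ 64 * (h : ℝ) ^ 2 / Hn R + 16 * (R : ℝ) ^ 2 := by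
  have hH := Hn_pos (N := R) (by omega)
  set a : ℝ := 2 * h / Hn R with ha
  have ha0 : 0 ≤ a := by positivity
  let u : ℕ → ℝ := fun n => if n < R then 2 * h - a * Hn n else 0
  let g : ℕ → ℤ := fun n => ⌊u n⌋
  have hu : ∀ n < R, u n - u (n + 1) = a / ((n : ℝ) + 1) := by
    intro n hn
    simp only [u, if_pos hn]
    split_ifs with h1
    · rw [Hn_succ]; ring
    · have : R = n + 1 := by omega
      have e : 2 * (h : ℝ) = a * Hn R := by rw [ha]; field_simp
      rw [e, this, Hn_succ]; ring
  refine ⟨fun x => g (nm x), ?_, ?_, ?_⟩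
  · have : nm (0, 0) = 0 := by simp [nm]
    simp only [this, g, u]
    rw [if_pos (by omega)]
    simp only [Hn, Finset.range_zero, Finset.sum_empty, mul_zero, sub_zero]
    have : (2 * (h : ℝ)) = ((2 * h : ℤ) : ℝ) := by push_cast; ring
    rw [this, Int.floor_intCast]
  · intro x hx
    simp only [g, u]; rw [if_neg (by omega)]; simp
  · refine (radial_en M R g (fun n hn => by simp only [g, u]; rw [if_neg (by omega)]; simp)
      (fun n => 2 * (a / ((n : ℝ) + 1)) ^ 2 + 2) ?_).trans ?_
    · intro n hn
      have h1 := hu n hn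
      have f1 := Int.floor_le (u n)
      have f2 := Int.lt_floor_add_one (u n)
      have f3 := Int.floor_le (u (n + 1))
      have f4 := Int.lt_floor_add_one (u (n + 1))
      have hp : 0 ≤ a / ((n : ℝ) + 1) := by positivity
      rw [← h1] at hp ⊢
      have g1 : |((g n : ℤ) : ℝ) - g (n + 1)| ≤ (u n - u (n + 1)) + 1 := by
        rw [abs_le]; simp only [g]; constructor <;> linarith
      have g2 := sq_le_sq' (abs_le.1 g1).1 (abs_le.1 g1).2
      nlinarith [sq_nonneg ((u n - u (n + 1)) - 1)]
    · have hterm : ∀ n ∈ Finset.range R, (4 * (2 * n + 1) : ℝ) * (2 * (a / ((n : ℝ) + 1)) ^ 2 + 2) ≤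
          16 * a ^ 2 * (1 / ((n : ℝ) + 1)) + 16 * R := by
        intro n hn
        have hn : (n : ℝ) + 1 ≤ R := by exact_mod_cast Finset.mem_range.1 hn
        have e : (a / ((n : ℝ) + 1)) ^ 2 = a ^ 2 * (1 / ((n : ℝ) + 1)) ^ 2 := by ring
        have e2 : ((n : ℝ) + 1) * (1 / ((n : ℝ) + 1)) = 1 := by field_simp
        rw [e]
        set t := 1 / ((n : ℝ) + 1)
        have ht : 0 ≤ t := by positivity
        have e3 : ((n : ℝ) + 1) * (a ^ 2 * t ^ 2) = a ^ 2 * t := by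
          calc _ = a ^ 2 * t * (((n : ℝ) + 1) * t) := by ring
            _ = _ := by rw [e2, mul_one]
        have : 0 ≤ a ^ 2 * t ^ 2 := by positivity
        nlinarith
      refine (Finset.sum_le_sum hterm).trans ?_
      rw [Finset.sum_add_distrib, ← Finset.mul_sum]
      simp only [Finset.sum_const, Finset.card_range, nsmul_eq_mul]
      have e1 : 16 * a ^ 2 * Hn R = 64 * (h : ℝ) ^ 2 / Hn R := by rw [ha]; field_simp; ring
      have : 16 * a ^ 2 * ∑ i ∈ Finset.range R, 1 / ((i : ℝ) + 1) = 64 * (h : ℝ) ^ 2 / Hn R := e1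
      rw [this]
      apply le_of_eq; ring

lemma lc_bounds (w : ℕ → ℝ) (hw : ∀ k, 0 < w k) (hlc : ∀ k, w (k + 2) * w k ≤ w (k + 1) * w (k + 1)) (j : ℕ) :
    (w (j + 1) / w j) ^ (j + 1) ≤ w (j + 1) / w 0 ∧
      w (2 * (j + 1)) / w (j + 1) ≤ (w (j + 1) / w j) ^ (j + 1) := by
  let r : ℕ → ℝ := fun k => w (k + 1) / w k
  have hr : Antitone r := antitone_nat_of_succ_le fun k => by
    simp only [r]
    rw [div_le_div_iff₀ (hw _) (hw _)]
    exact hlc k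
  have hr0 : ∀ k, 0 < r k := fun k => div_pos (hw _) (hw _)
  have hws : ∀ k, w (k + 1) = r k * w k := fun k => by
    simp only [r]; field_simp [(hw k).ne']
  have h1 : ∀ n, n ≤ j + 1 → r j ^ n * w 0 ≤ w n := by
    intro n
    induction n with
    | zero => intro _; simp
    | succ n ih =>
      intro hn
      rw [hws, pow_succ']
      rw [mul_assoc]
      exact mul_le_mul (hr (by omega)) (ih (by omega)) (by have := hr0 j; have := hw 0; positivity) (hr0 n).le
  have h2 : ∀ n, w (j + 1 + n) ≤ r j ^ n * w (j + 1) := by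
    intro n
    induction n with
    | zero => simp
    | succ n ih =>
      rw [← add_assoc, hws, pow_succ', mul_assoc]
      exact mul_le_mul (hr (by omega)) ih (hw _).le (hr0 j).le
  constructor
  · rw [le_div_iff₀ (hw 0)]
    exact h1 (j + 1) le_rfl
  · rw [div_le_iff₀ (hw _)]
    have := h2 (j + 1)
    rwa [← two_mul] at this

lemma log_half {h : ℕ} (hh : 2 ≤ h) : 1 / 2 ≤ Real.log h := by
  have h1 : Real.log 2 ≤ Real.log h := Real.log_le_log (by norm_num) (by exact_mod_cast hh)
  have := Real.log_two_gt_d9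
  linarith

lemma Q_bound {h : ℕ} (hh : 2 ≤ h) (n : ℕ) (hn : 1 ≤ n) :
    (h : ℝ) ^ 2 / (20 * Real.log h) ≤ (n : ℝ) / 2 + ((h : ℝ) - 1) ^ 2 / Hn (2 * n) := by
  have hl := log_half hh
  have hh' : (2 : ℝ) ≤ h := by exact_mod_cast hh
  have hH := Hn_pos (N := 2 * n) (by omega)
  have hl0 : 0 < Real.log h := by linarith
  by_cases hc : h ^ 2 ≤ n
  · have hc' : (h : ℝ) ^ 2 ≤ n := by exact_mod_cast hc
    have h1 : (h : ℝ) ^ 2 / (20 * Real.log h) ≤ (n : ℝ) / 2 := by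
      rw [div_le_iff₀ (by positivity)]
      nlinarith [sq_nonneg (h : ℝ)]
    have : 0 ≤ ((h : ℝ) - 1) ^ 2 / Hn (2 * n) := by positivity
    linarith
  · have hc' : (n : ℝ) ≤ (h : ℝ) ^ 2 := by exact_mod_cast (not_le.1 hc).le
    have hn' : (1 : ℝ) ≤ n := by exact_mod_cast hn
    have h1 : Hn (2 * n) ≤ 5 * Real.log h := by
      have a1 := harmonic_le_one_add_log (2 * n)
      rw [← Hn_eq] at a1
      have a2 : Real.log ((2 * n : ℕ) : ℝ) ≤ Real.log ((h : ℝ) ^ 3) := by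
        refine Real.log_le_log (by push_cast; positivity) ?_
        push_cast
        nlinarith [sq_nonneg (h : ℝ)]
      rw [Real.log_pow] at a2
      push_cast at a1 a2
      linarith
    have h2 : (h : ℝ) ^ 2 / (20 * Real.log h) ≤ ((h : ℝ) - 1) ^ 2 / Hn (2 * n) := by
      rw [div_le_div_iff₀ (by positivity) hH]
      have b1 : (h : ℝ) ^ 2 ≤ 4 * ((h : ℝ) - 1) ^ 2 := by nlinarith
      calc (h : ℝ) ^ 2 * Hn (2 * n) ≤ (4 * ((h : ℝ) - 1) ^ 2) * (5 * Real.log h) := by gcongr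
        _ = _ := by ring
    have : 0 ≤ (n : ℝ) / 2 := by positivity
    linarith

lemma E_bound {h : ℕ} (hh : 2 ≤ h) :
    64 * (h : ℝ) ^ 2 / Hn (Nat.sqrt h + 1) + 16 * ((Nat.sqrt h + 1 : ℕ) : ℝ) ^ 2 ≤ 192 * (h : ℝ) ^ 2 / Real.log h := by
  have hl := log_half hh
  have hl0 : 0 < Real.log h := by linarith
  have hh' : (2 : ℝ) ≤ h := by exact_mod_cast hh
  set s := Nat.sqrt h with hs
  have hH := Hn_pos (N := s + 1) (by omega)
  have s1 : 1 ≤ s := Nat.le_sqrt.2 (by omega)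
  have s2 : s * s ≤ h := Nat.sqrt_le h
  have s3 : h < (s + 1) * (s + 1) := Nat.lt_succ_sqrt h
  have s1' : (1 : ℝ) ≤ s := by exact_mod_cast s1
  have s2' : (s : ℝ) * s ≤ h := by exact_mod_cast s2
  have s3' : (h : ℝ) ≤ ((s : ℝ) + 1) ^ 2 := by
    have : (h : ℝ) < ((s : ℝ) + 1) * (s + 1) := by exact_mod_cast s3
    nlinarith
  have a1 : Real.log h / 2 ≤ Hn (s + 1) := by
    have b1 := log_add_one_le_harmonic (s + 1)
    rw [← Hn_eq] at b1
    have b2 : Real.log h ≤ Real.log (((s : ℝ) + 1) ^ 2) := Real.log_le_log (by linarith) s3'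
    rw [Real.log_pow] at b2
    have b3 : Real.log ((s : ℝ) + 1) ≤ Real.log ((s + 1 + 1 : ℕ) : ℝ) :=
      Real.log_le_log (by positivity) (by push_cast; linarith)
    push_cast at b1 b2 b3
    linarith
  have a2 : 64 * (h : ℝ) ^ 2 / Hn (s + 1) ≤ 128 * (h : ℝ) ^ 2 / Real.log h := by
    calc 64 * (h : ℝ) ^ 2 / Hn (s + 1) ≤ 64 * (h : ℝ) ^ 2 / (Real.log h / 2) := by gcongr
      _ = _ := by field_simp; ring
  have a3 : 16 * ((s + 1 : ℕ) : ℝ) ^ 2 ≤ 64 * (h : ℝ) := by push_cast; nlinarith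
  have a4 : 64 * (h : ℝ) ≤ 64 * (h : ℝ) ^ 2 / Real.log h := by
    rw [le_div_iff₀ hl0]
    have : Real.log h ≤ h := (Real.log_le_sub_one_of_pos (by linarith)).trans (by linarith)
    nlinarith
  calc _ ≤ 128 * (h : ℝ) ^ 2 / Real.log h + 64 * (h : ℝ) ^ 2 / Real.log h := by linarith
    _ = _ := by ring

/-- **Eq. (2.2).** Ratio of consecutive height probabilities in large balls:
`e^{−c₀βh/log h} ≤ π(η_0 = h)/π(η_0 = h−1) ≤ e^{−c₁βh/log h}`. -/
theorem dg_consecutive_height_ratio :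
    ∃ β₀ > (0 : ℝ), ∃ c₀ c₁ : ℝ, 0 < c₁ ∧ c₁ < c₀ ∧
      ∀ β ≥ β₀, ∀ h : ℕ, 2 ≤ h → ∃ L₀ : ℕ, ∀ L : ℕ, L₀ ≤ L →
        Real.exp (-c₀ * β * (h : ℝ) / Real.log h) ≤
            dgProb β (ball L) (fun η => η (0, 0) = (h : ℤ)) /
              dgProb β (ball L) (fun η => η (0, 0) = (h : ℤ) - 1) ∧
          dgProb β (ball L) (fun η => η (0, 0) = (h : ℤ)) /
              dgProb β (ball L) (fun η => η (0, 0) = (h : ℤ) - 1) ≤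
            Real.exp (-c₁ * β * (h : ℝ) / Real.log h) := by
  refine ⟨28, by norm_num, 192, 1 / 20, by norm_num, by norm_num, ?_⟩
  intro β hβ h hh
  have hβ0 : 0 < β := by linarith
  set R := Nat.sqrt h + 1 with hR
  refine ⟨2 * R, fun L hL => ?_⟩
  set Λ := ball (L : ℝ) with hΛdef
  have hΛ : Λ ⊆ Bx L := ball_sub_Bx L
  have h00 : (0, 0) ∈ Λ := by rw [hΛdef, mem_ball_iff]; simp
  set S := Λ.erase (0, 0) with hS
  set D := Dg (L + 1) with hD
  have hcoer : Coer D S := coer_Dg L S ((Finset.erase_subset _ _).trans hΛ)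
  have hfin0 : Th D β S 0 ≠ ⊤ := by
    obtain ⟨C, hC, H⟩ := Th_bdd D β hβ0 S hcoer
    exact ne_top_of_le_ne_top hC (H 0 fun _ _ => rfl)
  have hle0 : ∀ t : ℝ, Th D β S (t • dl) ≤ Th D β S 0 := fun t => by
    have := Th_cap D β hβ0 S hcoer dl t 0 (fun g _ => en_nonneg _ _)
    simpa using this
  have hfin : ∀ t : ℝ, Th D β S (t • dl) ≠ ⊤ := fun t => ne_top_of_le_ne_top hfin0 (hle0 t)
  let w : ℕ → ℝ := fun k => (Th D β S ((k : ℝ) • dl)).toReal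
  have hw : ∀ k, 0 < w k := fun k => ENNReal.toReal_pos (Th_pos _ _ _ _).ne' (hfin _)
  have hlc : ∀ k, w (k + 2) * w k ≤ w (k + 1) * w (k + 1) := by
    intro k
    have := Th_logconcave D β hβ0 Λ h00 (k + 1)
    simp only [w]
    rw [← ENNReal.toReal_mul, ← ENNReal.toReal_mul]
    refine ENNReal.toReal_mono (ENNReal.mul_ne_top (hfin _) (hfin _)) ?_
    push_cast at this ⊢
    rw [show (k : ℝ) + 1 + 1 = k + 2 by ring, show (k : ℝ) + 1 - 1 = k by ring] at this
    exact this
  obtain ⟨j, rfl⟩ : ∃ j, h = j + 1 := ⟨h - 1, by omega⟩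
  have hratio : dgProb β Λ (fun η => η (0, 0) = ((j + 1 : ℕ) : ℤ)) /
      dgProb β Λ (fun η => η (0, 0) = ((j + 1 : ℕ) : ℤ) - 1) = w (j + 1) / w j := by
    have t0 := dgW_true L β hβ0 Λ hΛ
    have e1 := dgW_eq L β Λ hΛ h00 ((j + 1 : ℕ) : ℤ)
    have e2 := dgW_eq L β Λ hΛ h00 (((j + 1 : ℕ) : ℤ) - 1)
    have f1 : dgW β Λ (fun η => η (0, 0) = ((j + 1 : ℕ) : ℤ)) = w (j + 1) := by
      rw [e1]; simp [w, hS, hD]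
    have f2 : dgW β Λ (fun η => η (0, 0) = ((j + 1 : ℕ) : ℤ) - 1) = w j := by
      rw [e2]; simp [w, hS, hD]
    rw [dgProb, dgProb, f1, f2]
    rw [div_div_div_cancel_right₀ t0.ne']
  rw [hratio]
  obtain ⟨b1, b2⟩ := lc_bounds w hw hlc j
  have hr0 : 0 < w (j + 1) / w j := div_pos (hw _) (hw _)
  set r := w (j + 1) / w j
  set H : ℝ := ((j + 1 : ℕ) : ℝ) with hH
  have hlog : 0 < Real.log H := by have := log_half hh; linarith
  have hw0 : w 0 = (Th D β S 0).toReal := by simp [w]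
  have up : w (j + 1) / w 0 ≤ Real.exp (-β * (H ^ 2 / (20 * Real.log H))) := by
    rw [div_le_iff₀ (hw 0), hw0]
    have hp : ((L : ℤ) + 1, (0 : ℤ)) ∉ Λ := by
      rw [hΛdef, mem_ball_iff]; push Not; nlinarith [Int.natCast_nonneg L]
    have := upper_bound L β hβ Λ hΛ h00 _ hp (ball_out L) ((j + 1 : ℕ) : ℤ) (by omega)
      (H ^ 2 / (20 * Real.log H)) (fun n hn => by rw [Int.cast_natCast]; exact Q_bound hh n hn)
    have h3 := ENNReal.toReal_mono (ENNReal.mul_ne_top ENNReal.ofReal_ne_top hfin0) this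
    rw [ENNReal.toReal_mul, ENNReal.toReal_ofReal (Real.exp_pos _).le] at h3
    simpa [w] using h3
  have low : Real.exp (-β * (192 * H ^ 2 / Real.log H)) ≤ w (2 * (j + 1)) / w (j + 1) := by
    obtain ⟨φ, p1, p2, p3⟩ := phi_exists (L + 1) (j + 1) R (by omega)
    have hφΛ : ∀ x ∉ Λ, φ x = 0 := by
      intro x hx
      apply p2
      by_contra hc
      apply hx
      rw [hΛdef, mem_ball_iff]
      simp only [nm, not_le, max_lt_iff] at hc
      have c1 : |x.1| ≤ |(R : ℤ)| := by rw [Int.abs_eq_natAbs, Int.abs_eq_natAbs]; omega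
      have c2 : |x.2| ≤ |(R : ℤ)| := by rw [Int.abs_eq_natAbs, Int.abs_eq_natAbs]; omega
      have d1 := sq_le_sq.2 c1
      have d2 := sq_le_sq.2 c2
      have hL' : 2 * (R : ℤ) ≤ L := by exact_mod_cast hL
      nlinarith [Int.natCast_nonneg R]
    let m : LatS S := ⟨fun x => if x = (0, 0) then 0 else φ x, fun x hx => by
      by_cases h0 : x = (0, 0)
      · simp [h0]
      · simp only [h0, if_false]
        exact hφΛ x (fun h => hx (Finset.mem_erase.2 ⟨h0, h⟩))⟩
    have hre : re φ = re m + ((2 * (j + 1) : ℕ) : ℝ) • dl := by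
      ext x
      by_cases h0 : x = (0, 0)
      · subst h0; simp [re, m, dl, p1]
      · simp [re, m, dl, h0]
    have s1 := Th_shift_ge D β S (re φ)
    rw [hre, Th_translate, ← hre] at s1
    have s2 := ENNReal.toReal_mono (hfin _) s1
    rw [ENNReal.toReal_mul, wt, ENNReal.toReal_ofReal (Real.exp_pos _).le, ← hw0] at s2
    have s3 : w (j + 1) ≤ w 0 := by
      rw [hw0]; exact ENNReal.toReal_mono hfin0 (hle0 _)
    rw [le_div_iff₀ (hw _)]
    have s4 : Real.exp (-β * (192 * H ^ 2 / Real.log H)) ≤ Real.exp (-β * en D (re φ)) := by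
      refine Real.exp_le_exp.2 ?_
      have := mul_le_mul_of_nonneg_left (p3.trans (E_bound hh)) hβ0.le
      linarith
    calc _ ≤ Real.exp (-β * en D (re φ)) * w 0 :=
          mul_le_mul s4 s3 (hw _).le (Real.exp_pos _).le
      _ ≤ _ := s2
  constructor
  · refine le_of_pow_le_pow_left₀ (n := j + 1) (by omega) hr0.le ?_
    refine le_trans (le_of_eq ?_) (low.trans b2)
    rw [← Real.exp_nat_mul]
    congr 1
    rw [← hH]; ring
  · refine le_of_pow_le_pow_left₀ (n := j + 1) (by omega) (Real.exp_pos _).le ?_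
    refine le_trans (b1.trans up) (le_of_eq ?_)
    rw [← Real.exp_nat_mul]
    congr 1
    rw [← hH]; field_simp
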